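/- arXiv:2204.03624 — 8 statements merged into one kernel-verified Lean document; each statement's English description precedes it below -/
import Mathlib

section
/- Let n ≥ 1 and let X ∈ M(n,ℍ) be a quaternionic matrix with tr(Φ(X)) = 0. Then there exists an invertible matrix g ∈ M(n,ℍ) such that g * X * g⁻¹ = -X if and only if there exists g ∈ M(n,ℍ) with det(Φ(g)) = 1 such that g * X * g⁻¹ = -X. (That is, an element of sl(n,ℍ) is Ad_{GL(n,ℍ)}-real if and only if it is Ad_{SL(n,ℍ)}-real.) -/
/-- The embedding Φ : M(n,ℍ) → M(2n,ℂ), written as a block matrix. -/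
noncomputable def Phi {m : Type*} [Fintype m] [DecidableEq m]
    (A : Matrix m m (Quaternion ℝ)) : Matrix (m ⊕ m) (m ⊕ m) ℂ :=
  Matrix.fromBlocks
    (Matrix.of fun k l => (⟨(A k l).re, (A k l).imI⟩ : ℂ))
    (Matrix.of fun k l => (⟨(A k l).imJ, (A k l).imK⟩ : ℂ))
    (-(Matrix.of fun k l => (starRingEnd ℂ) (⟨(A k l).imJ, (A k l).imK⟩ : ℂ)))
    (Matrix.of fun k l => (starRingEnd ℂ) (⟨(A k l).re, (A k l).imI⟩ : ℂ))

open Matrix Filter Topology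
open scoped ComplexOrder

theorem Phi_one {m : Type*} [Fintype m] [DecidableEq m] :
    Phi (1 : Matrix m m (Quaternion ℝ)) = 1 := by
  ext (i | i) (j | j) <;> by_cases h : i = j <;>
    simp [Phi, Matrix.one_apply, h, Complex.ext_iff,
      Quaternion.re_one, Quaternion.imI_one, Quaternion.imJ_one, Quaternion.imK_one,
      Quaternion.re_zero, Quaternion.imI_zero, Quaternion.imJ_zero, Quaternion.imK_zero]

theorem Phi_mul {m : Type*} [Fintype m] [DecidableEq m]
    (A B : Matrix m m (Quaternion ℝ)) : Phi (A * B) = Phi A * Phi B := by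
  have hre (f : m → Quaternion ℝ) : (∑ i, f i).re = ∑ i, (f i).re :=
    map_sum (⟨⟨fun q => q.re, rfl⟩, fun _ _ => rfl⟩ : Quaternion ℝ →+ ℝ) f _
  have hI (f : m → Quaternion ℝ) : (∑ i, f i).imI = ∑ i, (f i).imI :=
    map_sum (⟨⟨fun q => q.imI, rfl⟩, fun _ _ => rfl⟩ : Quaternion ℝ →+ ℝ) f _
  have hJ (f : m → Quaternion ℝ) : (∑ i, f i).imJ = ∑ i, (f i).imJ :=
    map_sum (⟨⟨fun q => q.imJ, rfl⟩, fun _ _ => rfl⟩ : Quaternion ℝ →+ ℝ) f _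
  have hK (f : m → Quaternion ℝ) : (∑ i, f i).imK = ∑ i, (f i).imK :=
    map_sum (⟨⟨fun q => q.imK, rfl⟩, fun _ _ => rfl⟩ : Quaternion ℝ →+ ℝ) f _
  ext (i | i) (j | j) <;> apply Complex.ext <;>
    simp only [Phi, Matrix.mul_apply, Fintype.sum_sum_type, fromBlocks_apply₁₁,
      fromBlocks_apply₁₂, fromBlocks_apply₂₁, fromBlocks_apply₂₂, of_apply, Matrix.neg_apply,
      Complex.add_re, Complex.add_im, Complex.re_sum, Complex.im_sum, Complex.mul_re,
      Complex.mul_im, Complex.conj_re, Complex.conj_im, Complex.neg_re, Complex.neg_im,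
      hre, hI, hJ, hK, Quaternion.re_mul, Quaternion.imI_mul, Quaternion.imJ_mul,
      Quaternion.imK_mul, ← Finset.sum_add_distrib, ← Finset.sum_neg_distrib] <;>
    exact Finset.sum_congr rfl fun _ _ => by ring

theorem Phi_smul {m : Type*} [Fintype m] [DecidableEq m] (c : ℝ)
    (A : Matrix m m (Quaternion ℝ)) : Phi (c • A) = (c : ℂ) • Phi A := by
  ext (i | i) (j | j) <;> simp [Phi, Complex.ext_iff]

theorem Phi_zero {m : Type*} [Fintype m] [DecidableEq m] :
    Phi (0 : Matrix m m (Quaternion ℝ)) = 0 := by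
  simpa using Phi_smul 0 (0 : Matrix m m (Quaternion ℝ))

theorem Phi_injective {m : Type*} [Fintype m] [DecidableEq m] :
    Function.Injective (Phi : Matrix m m (Quaternion ℝ) → _) := by
  intro A B h
  ext i j
  all_goals
    have h₁ := congrFun (congrFun h (.inl i)) (.inl j)
    have h₂ := congrFun (congrFun h (.inl i)) (.inr j)
    simp only [Phi, fromBlocks_apply₁₁, fromBlocks_apply₁₂, of_apply, Complex.mk.injEq] at h₁ h₂
    tauto

theorem Phi_reindex {m k : Type*} [Fintype m] [DecidableEq m] [Fintype k] [DecidableEq k]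
    (e : k ≃ m) (A : Matrix m m (Quaternion ℝ)) :
    Phi (A.submatrix e e) = (Phi A).submatrix (e.sumCongr e) (e.sumCongr e) := by
  ext (i | i) (j | j) <;> rfl

theorem det_Phi_reindex {m k : Type*} [Fintype m] [DecidableEq m] [Fintype k] [DecidableEq k]
    (e : k ≃ m) (A : Matrix m m (Quaternion ℝ)) :
    (Phi (A.submatrix e e)).det = (Phi A).det := by
  rw [Phi_reindex, det_submatrix_equiv_self]

theorem continuous_Phi {m : Type*} [Fintype m] [DecidableEq m] :
    Continuous (Phi : Matrix m m (Quaternion ℝ) → _) := by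
  have h : Continuous fun p : ℝ × ℝ => (⟨p.1, p.2⟩ : ℂ) :=
    Complex.equivRealProdCLM.symm.continuous
  have h₁ : Continuous fun q : Quaternion ℝ => (⟨q.re, q.imI⟩ : ℂ) :=
    h.comp (Quaternion.continuous_re.prodMk Quaternion.continuous_imI)
  have h₂ : Continuous fun q : Quaternion ℝ => (⟨q.imJ, q.imK⟩ : ℂ) :=
    h.comp (Quaternion.continuous_imJ.prodMk Quaternion.continuous_imK)
  have hc := Complex.continuous_conj
  have he (i j : m) : Continuous fun A : Matrix m m (Quaternion ℝ) => A i j :=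
    continuous_id.matrix_elem i j
  refine continuous_matrix fun i j => ?_
  rcases i with i | i <;> rcases j with j | j
  · exact h₁.comp (he i j)
  · exact h₂.comp (he i j)
  · exact (hc.comp (h₂.comp (he i j))).neg
  · exact hc.comp (h₁.comp (he i j))

theorem det_Phi_fromBlocks_zero₁₂ {m k : Type*} [Fintype m] [DecidableEq m] [Fintype k]
    [DecidableEq k] (A : Matrix m m (Quaternion ℝ)) (C : Matrix k m (Quaternion ℝ))
    (D : Matrix k k (Quaternion ℝ)) :
    (Phi (fromBlocks A 0 C D)).det = (Phi A).det * (Phi D).det := by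
  rw [← det_submatrix_equiv_self (Equiv.sumSumSumComm m m k k), ← det_fromBlocks_zero₁₂ (Phi A)
    ((Phi (fromBlocks A 0 C D)).submatrix (Equiv.sumSumSumComm m m k k)
      (Equiv.sumSumSumComm m m k k)).toBlocks₂₁ (Phi D)]
  congr 1
  ext ((i | i) | (i | i)) ((j | j) | (j | j)) <;>
    simp [Phi, toBlocks₂₁, Complex.ext_iff, Quaternion.re_zero, Quaternion.imI_zero,
      Quaternion.imJ_zero, Quaternion.imK_zero]

theorem det_Phi_fromBlocks_zero₂₁ {m k : Type*} [Fintype m] [DecidableEq m] [Fintype k]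
    [DecidableEq k] (A : Matrix m m (Quaternion ℝ)) (B : Matrix m k (Quaternion ℝ))
    (D : Matrix k k (Quaternion ℝ)) :
    (Phi (fromBlocks A B 0 D)).det = (Phi A).det * (Phi D).det := by
  rw [← det_Phi_reindex (Equiv.sumComm k m), mul_comm, ← det_Phi_fromBlocks_zero₁₂ D B A]
  congr 2
  ext (i | i) (j | j) <;> rfl

/-- The Schur complement formula for the quaternionic determinant. -/
theorem det_Phi_fromBlocks {m k : Type*} [Fintype m] [DecidableEq m] [Fintype k]
    [DecidableEq k] (A A' : Matrix m m (Quaternion ℝ)) (h : A * A' = 1)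
    (B : Matrix m k (Quaternion ℝ)) (C : Matrix k m (Quaternion ℝ))
    (D : Matrix k k (Quaternion ℝ)) :
    (Phi (fromBlocks A B C D)).det = (Phi A).det * (Phi (D - C * A' * B)).det := by
  have key : fromBlocks A B C D =
      fromBlocks A 0 C (D - C * A' * B) * fromBlocks 1 (A' * B) 0 1 := by
    simp [fromBlocks_multiply, ← Matrix.mul_assoc, h]
  rw [key, Phi_mul, det_mul, det_Phi_fromBlocks_zero₁₂, det_Phi_fromBlocks_zero₂₁]
  simp [Phi_one]

theorem det_Phi_fin_one (A : Matrix (Fin 1) (Fin 1) (Quaternion ℝ)) :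
    (Phi A).det = ((A 0 0).re ^ 2 + (A 0 0).imI ^ 2 + (A 0 0).imJ ^ 2 + (A 0 0).imK ^ 2 : ℝ) := by
  rw [← det_submatrix_equiv_self (finSumFinEquiv (m := 1) (n := 1)).symm]
  have h0 : (finSumFinEquiv (m := 1) (n := 1)).symm 0 = .inl 0 := rfl
  have h1 : (finSumFinEquiv (m := 1) (n := 1)).symm 1 = .inr 0 := rfl
  rw [det_fin_two]
  simp only [submatrix_apply, h0, h1, Phi, fromBlocks_apply₁₁, fromBlocks_apply₁₂,
    fromBlocks_apply₂₁, fromBlocks_apply₂₂, of_apply, Matrix.neg_apply]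
  apply Complex.ext
  · simp only [Complex.sub_re, Complex.mul_re, Complex.neg_re, Complex.neg_im, Complex.conj_re,
      Complex.conj_im, Complex.ofReal_re]
    ring
  · simp only [Complex.sub_im, Complex.mul_im, Complex.neg_re, Complex.neg_im, Complex.conj_re,
      Complex.conj_im, Complex.ofReal_im]
    ring

/-- The quaternionic determinant takes nonnegative real values. -/
theorem det_Phi_nonneg (n : ℕ) (A : Matrix (Fin n) (Fin n) (Quaternion ℝ)) :
    0 ≤ (Phi A).det := by
  induction n with
  | zero => simp
  | succ n ih =>
    have pivot (A : Matrix (Fin (n + 1)) (Fin (n + 1)) (Quaternion ℝ)) (hA : A 0 0 ≠ 0) :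
        0 ≤ (Phi A).det := by
      let e : Fin 1 ⊕ Fin n ≃ Fin (n + 1) := finSumFinEquiv.trans (finCongr (Nat.add_comm 1 n))
      have he : e (.inl 0) = 0 := by ext; simp [e]
      rw [← det_Phi_reindex e, ← fromBlocks_toBlocks (A.submatrix e e)]
      have h00 : (A.submatrix e e).toBlocks₁₁ = of fun _ _ => A 0 0 := by
        ext i j
        all_goals
          rw [Subsingleton.elim i 0, Subsingleton.elim j 0]
          simp [toBlocks₁₁, he]
      rw [det_Phi_fromBlocks _ (of fun _ _ => (A 0 0)⁻¹)]
      · refine mul_nonneg ?_ (ih _)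
        rw [det_Phi_fin_one, Complex.zero_le_real]
        positivity
      · rw [h00, ← Matrix.ext_iff]
        intro i j
        rw [Subsingleton.elim i j]
        simp [Matrix.mul_apply, hA]
    by_cases hA : A 0 0 = 0
    · have hc : Continuous fun t : ℝ => (Phi (A + t • 1)).det := by
        refine (continuous_Phi.comp ?_).matrix_det
        fun_prop
      have hlim : Tendsto (fun t : ℝ => (Phi (A + t • 1)).det) (𝓝[≠] 0) (𝓝 (Phi A).det) := by
        simpa using (hc.tendsto 0).mono_left nhdsWithin_le_nhds
      refine ge_of_tendsto hlim ?_
      filter_upwards [self_mem_nhdsWithin] with t ht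
      exact pivot _ (by simpa [hA] using ht)
    · exact pivot A hA

theorem isUnit_of_isUnit_det_Phi {m : Type*} [Fintype m] [DecidableEq m]
    {A : Matrix m m (Quaternion ℝ)} (h : IsUnit (Phi A).det) : IsUnit A := by
  have hinj : Function.Injective (LinearMap.mulLeft ℝ A) := by
    rw [injective_iff_map_eq_zero]
    intro B hB
    have hAB : Phi A * Phi B = 0 := by
      rw [← Phi_mul, ← LinearMap.mulLeft_apply (R := ℝ), hB, Phi_zero]
    apply Phi_injective
    rw [Phi_zero, ← nonsing_inv_mul_cancel_left (Phi A) (Phi B) h, hAB, Matrix.mul_zero]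
  obtain ⟨B, hB⟩ := (LinearMap.injective_iff_surjective.mp hinj) 1
  rw [LinearMap.mulLeft_apply] at hB
  exact IsUnit.of_mul_eq_one B hB

/-- Every invertible quaternionic matrix is a real multiple of one of determinant one. -/
theorem exists_det_Phi_smul_eq_one {n : ℕ} (hn : 1 ≤ n)
    {g : Matrix (Fin n) (Fin n) (Quaternion ℝ)} (hg : IsUnit g) :
    ∃ c : ℝ, (Phi (c • g)).det = 1 := by
  obtain ⟨r, hr⟩ : ∃ r : ℝ, (Phi g).det = r :=
    ⟨_, (Complex.nonneg_iff.mp (det_Phi_nonneg n g)).2 ▸ (Complex.eta _).symm⟩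
  have hr0 : 0 ≤ r := by simpa [hr] using det_Phi_nonneg n g
  have hne : r ≠ 0 := by
    rintro rfl
    obtain ⟨B, hB⟩ := hg.exists_right_inv
    have := congrArg (fun M => (Phi M).det) hB
    simp [Phi_mul, Phi_one, hr] at this
  refine ⟨(r⁻¹) ^ (((n + n : ℕ) : ℝ)⁻¹), ?_⟩
  rw [Phi_smul, det_smul, hr, Fintype.card_sum, Fintype.card_fin, ← Complex.ofReal_pow,
    Real.rpow_inv_natCast_pow (inv_nonneg.mpr hr0) (by omega), ← Complex.ofReal_mul,
    inv_mul_cancel₀ hne, Complex.ofReal_one]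

/-- An element of sl(n,ℍ) is Ad_{GL(n,ℍ)}-real iff it is Ad_{SL(n,ℍ)}-real. -/
theorem adGL_real_iff_adSL_real_quaternion (n : ℕ) (hn : 1 ≤ n)
    (X : Matrix (Fin n) (Fin n) (Quaternion ℝ)) (htr : (Phi X).trace = 0) :
    (∃ g : Matrix (Fin n) (Fin n) (Quaternion ℝ), IsUnit g ∧ g * X = -X * g) ↔
      (∃ g : Matrix (Fin n) (Fin n) (Quaternion ℝ), (Phi g).det = 1 ∧ g * X = -X * g) := by
  constructor
  · rintro ⟨g, hg, h⟩
    obtain ⟨c, hc⟩ := exists_det_Phi_smul_eq_one hn hg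
    exact ⟨c • g, hc, by rw [Matrix.smul_mul, h, Matrix.mul_smul]⟩
  · rintro ⟨g, hg, h⟩
    exact ⟨g, isUnit_of_isUnit_det_Phi (hg ▸ isUnit_one), h⟩
end

section
/- Let n ≥ 1 and let X ∈ M(n,ℂ) be a nonzero matrix with trace 0. Then X is Ad_{SL(n,ℂ)}-real if and only if for every λ ∈ ℂ and every natural number k, the ℂ-dimension of the kernel of (X − λ·1)^k equals the ℂ-dimension of the kernel of (X + λ·1)^k. (The latter condition says precisely that whenever λ is an eigenvalue of X, then −λ is also an eigenvalue of X with the same multiplicity, and the Jordan partitions of X at λ and at −λ coincide.) -/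
/-- The ℂ-dimension of the kernel of (the linear map associated to) a complex matrix. -/
noncomputable def kerDim {m : Type*} [Fintype m] (Y : Matrix m m ℂ) : ℕ :=
  Module.finrank ℂ (LinearMap.ker Y.mulVecLin)

open Polynomial in
/-- The dimension of the kernel of multiplication by `f` on a `K[X]`-module. -/
noncomputable def polyKerDim (K M : Type*) [Field K] [AddCommGroup M] [Module K M]
    [Module K[X] M] [IsScalarTower K K[X] M] (f : K[X]) : ℕ :=
  Module.finrank K (LinearMap.ker (Algebra.lsmul K K M f))

section PolyKerDim

open Polynomial

universe u

variable {K : Type*} [Field K]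

theorem finrank_ker_eq_of_conj {M N : Type*} [AddCommGroup M] [Module K M] [AddCommGroup N]
    [Module K N] (e : M ≃ₗ[K] N) (f : Module.End K M) (g : Module.End K N)
    (h : ∀ x, e (f x) = g (e x)) :
    Module.finrank K (LinearMap.ker f) = Module.finrank K (LinearMap.ker g) := by
  have hker : LinearMap.ker g = (LinearMap.ker f).map (e : M →ₗ[K] N) := by
    ext y
    rw [Submodule.mem_map_equiv, LinearMap.mem_ker, LinearMap.mem_ker,
      ← e.map_eq_zero_iff (x := f _), h, e.apply_symm_apply]
  rw [hker]
  exact (LinearEquiv.finrank_map_eq e _).symm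

theorem polyKerDim_congr {M N : Type*} [AddCommGroup M] [Module K M] [Module K[X] M]
    [IsScalarTower K K[X] M] [AddCommGroup N] [Module K N] [Module K[X] N]
    [IsScalarTower K K[X] N] (e : M ≃ₗ[K[X]] N) (f : K[X]) :
    polyKerDim K M f = polyKerDim K N f :=
  finrank_ker_eq_of_conj (e.restrictScalars K) _ _ fun x => by simp

theorem polyKerDim_pi {ι : Type*} [Fintype ι] (M : ι → Type*) [∀ i, AddCommGroup (M i)]
    [∀ i, Module K (M i)] [∀ i, Module K[X] (M i)] [∀ i, IsScalarTower K K[X] (M i)]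
    [∀ i, Module.Finite K (M i)] (f : K[X]) :
    polyKerDim K (∀ i, M i) f = ∑ i, polyKerDim K (M i) f := by
  unfold polyKerDim
  rw [← Module.finrank_pi_fintype K]
  refine LinearEquiv.finrank_eq
    { toFun := fun x i => ⟨x.1 i, congrFun x.2 i⟩
      map_add' := fun _ _ => rfl
      map_smul' := fun _ _ => rfl
      invFun := fun x => ⟨fun i => (x i).1, funext fun i => (x i).2⟩
      left_inv := fun _ => rfl
      right_inv := fun _ => rfl }

/-- The indecomposable torsion `K[X]`-module corresponding to a single Jordan block. -/
abbrev JordanBlockModule (K : Type*) [Field K] (a : K × ℕ) : Type _ :=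
  K[X] ⧸ Ideal.span {(X - C a.1) ^ a.2}

instance (a : K × ℕ) : Module.Finite K (JordanBlockModule K a) :=
  ((monic_X_sub_C a.1).pow a.2).finite_quotient

theorem polyKerDim_quotient {p : K[X]} (hp : p.Monic) (f : K[X]) :
    polyKerDim K (K[X] ⧸ Ideal.span {p}) f =
      Module.finrank K (K[X] ⧸ Ideal.span {p} ⊔ Ideal.span {f}) := by
  have := hp.finite_quotient
  set I := Ideal.span {p}
  let φ := Algebra.lsmul K K (K[X] ⧸ I) f
  have h1 := φ.finrank_range_add_finrank_ker
  have h2 := (LinearMap.range φ).finrank_quotient_add_finrank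
  have h3 : Module.finrank K ((K[X] ⧸ I) ⧸ LinearMap.range φ) =
      Module.finrank K ((K[X] ⧸ I) ⧸ (Ideal.span {f}).map (Ideal.Quotient.mkₐ K I)) := by
    have : LinearMap.range φ =
        ((Ideal.span {f}).map (Ideal.Quotient.mkₐ K I)).restrictScalars K := by
      ext y
      simp only [LinearMap.mem_range, Submodule.restrictScalars_mem, Ideal.map_span,
        Set.image_singleton, Ideal.mem_span_singleton', φ]
      refine exists_congr fun x => ?_
      obtain ⟨x, rfl⟩ := Ideal.Quotient.mk_surjective x
      rw [mul_comm]
      rfl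
    rw [this]
    rfl
  have h4 := (DoubleQuot.quotQuotEquivQuotSupₐ K I (Ideal.span {f})).toLinearEquiv.finrank_eq
  change Module.finrank K (LinearMap.ker φ) = _
  omega

theorem polyKerDim_jordanBlockModule (a : K × ℕ) (c : K) (k : ℕ) [Decidable (a.1 = c)] :
    polyKerDim K (JordanBlockModule K a) ((X - C c) ^ k) =
      if a.1 = c then min a.2 k else 0 := by
  rw [polyKerDim_quotient ((monic_X_sub_C a.1).pow a.2)]
  split_ifs with h
  · subst h
    have hs : Ideal.span {(X - C a.1) ^ a.2} ⊔ Ideal.span {(X - C a.1) ^ k} =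
        Ideal.span {(X - C a.1) ^ min a.2 k} := by
      rcases le_total a.2 k with h | h
      · rw [min_eq_left h, sup_eq_left]
        exact Ideal.span_singleton_le_span_singleton.2 (pow_dvd_pow _ h)
      · rw [min_eq_right h, sup_eq_right]
        exact Ideal.span_singleton_le_span_singleton.2 (pow_dvd_pow _ h)
    rw [hs, finrank_quotient_span_eq_natDegree, natDegree_pow, natDegree_X_sub_C, mul_one]
  · have hs : Ideal.span {(X - C a.1) ^ a.2} ⊔ Ideal.span {(X - C c) ^ k} = ⊤ := by
      rw [← Ideal.isCoprime_iff_sup_eq, Ideal.isCoprime_span_singleton_iff]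
      exact (isCoprime_X_sub_C_of_isUnit_sub (sub_ne_zero.2 h).isUnit).pow
    rw [hs]
    exact Module.finrank_zero_of_subsingleton

theorem polyKerDim_pi_jordanBlockModule [DecidableEq K] {ι : Type*} [Fintype ι] (a : ι → K × ℕ)
    (c : K) (k : ℕ) :
    polyKerDim K (∀ i, JordanBlockModule K (a i)) ((X - C c) ^ k) =
      ∑ i, if (a i).1 = c then min (a i).2 k else 0 := by
  rw [polyKerDim_pi]
  exact Finset.sum_congr rfl fun i _ => polyKerDim_jordanBlockModule (a i) c k

theorem two_mul_sum_min_eq {α ι : Type*} [DecidableEq α] [Fintype ι] (a : ι → α × ℕ) (c : α)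
    (k : ℕ) :
    2 * (∑ i, if (a i).1 = c then min (a i).2 (k + 1) else 0) =
      (∑ i, if (a i).1 = c then min (a i).2 k else 0) +
      (∑ i, if (a i).1 = c then min (a i).2 (k + 2) else 0) +
      Fintype.card {i // a i = (c, k + 1)} := by
  rw [Fintype.card_subtype, Finset.card_filter, Finset.mul_sum, ← Finset.sum_add_distrib,
    ← Finset.sum_add_distrib]
  refine Finset.sum_congr rfl fun i _ => ?_
  by_cases hc : (a i).1 = c
  · simp only [Prod.ext_iff, hc, true_and, if_true]
    split_ifs <;> omega
  · simp [Prod.ext_iff, hc]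

theorem card_fiber_eq_of_sum_min_eq {α ι κ : Type*} [DecidableEq α] [Fintype ι] [Fintype κ]
    (a : ι → α × ℕ) (b : κ → α × ℕ)
    (h : ∀ c k, (∑ i, if (a i).1 = c then min (a i).2 k else 0) =
      ∑ j, if (b j).1 = c then min (b j).2 k else 0) (c : α) (k : ℕ) :
    Fintype.card {i // a i = (c, k + 1)} = Fintype.card {j // b j = (c, k + 1)} := by
  have ha := two_mul_sum_min_eq a c k
  have hb := two_mul_sum_min_eq b c k
  rw [h, h, h] at ha
  omega

theorem exists_equiv_of_sum_min_eq {α ι κ : Type*} [DecidableEq α] [Fintype ι] [Fintype κ]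
    (a : ι → α × ℕ) (b : κ → α × ℕ) (ha : ∀ i, (a i).2 ≠ 0) (hb : ∀ j, (b j).2 ≠ 0)
    (h : ∀ c k, (∑ i, if (a i).1 = c then min (a i).2 k else 0) =
      ∑ j, if (b j).1 = c then min (b j).2 k else 0) :
    ∃ σ : ι ≃ κ, ∀ i, b (σ i) = a i := by
  have hcard : ∀ x, Nonempty ({i // a i = x} ≃ {j // b j = x}) := by
    rintro ⟨c, _ | k⟩
    · have : IsEmpty {i // a i = (c, 0)} := ⟨fun i => ha i (by rw [i.2])⟩
      have : IsEmpty {j // b j = (c, 0)} := ⟨fun j => hb j (by rw [j.2])⟩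
      exact ⟨Equiv.equivOfIsEmpty _ _⟩
    · exact Fintype.card_eq.1 (card_fiber_eq_of_sum_min_eq a b h c k)
  exact ⟨Equiv.ofFiberEquiv fun x => (hcard x).some, Equiv.ofFiberEquiv_map _⟩

/-- Factors indexed outside `P` may be dropped from a product if they are trivial. -/
theorem nonempty_pi_equiv_pi_subtype {R ι : Type*} [Semiring R] (M : ι → Type*)
    [∀ i, AddCommMonoid (M i)] [∀ i, Module R (M i)] (P : ι → Prop)
    (h : ∀ i, ¬ P i → Subsingleton (M i)) :
    Nonempty ((∀ i, M i) ≃ₗ[R] ∀ i : {i // P i}, M i) := by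
  classical
  refine ⟨LinearEquiv.ofBijective
    (LinearMap.pi fun i : {i // P i} => LinearMap.proj (R := R) (φ := M) i.1) ⟨?_, ?_⟩⟩
  · intro x y hxy
    ext i
    by_cases hi : P i
    · exact congrFun hxy ⟨i, hi⟩
    · exact (h i hi).elim _ _
  · intro y
    refine ⟨fun i => if hi : P i then y ⟨i, hi⟩ else 0, ?_⟩
    ext i
    simp [i.2]

theorem exists_equiv_pi_jordanBlockModule {K : Type u} [Field K] [IsAlgClosed K] {M : Type*}
    [AddCommGroup M]
    [Module K[X] M] [Module.Finite K[X] M] (hM : Module.IsTorsion K[X] M) :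
    ∃ (ι : Type u) (_ : Fintype ι) (a : ι → K × ℕ), (∀ i, (a i).2 ≠ 0) ∧
      Nonempty (M ≃ₗ[K[X]] ∀ i, JordanBlockModule K (a i)) := by
  classical
  obtain ⟨ι, _, p, hp, e, ⟨E⟩⟩ := Module.equiv_directSum_of_isTorsion hM
  have hroot : ∀ i, ∃ c, Associated (p i) (X - C c) := fun i => by
    obtain ⟨c, hc⟩ := IsAlgClosed.exists_root (p i)
      (degree_pos_of_irreducible (hp i)).ne'
    exact ⟨c, ((irreducible_X_sub_C c).associated_of_dvd (hp i) (dvd_iff_isRoot.2 hc)).symm⟩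
  choose c hc using hroot
  have hspan : ∀ i, Submodule.span K[X] {p i ^ e i} = Ideal.span {(X - C (c i)) ^ e i} :=
    fun i => Ideal.span_singleton_eq_span_singleton.2 (hc i).pow_pow
  obtain ⟨F⟩ := nonempty_pi_equiv_pi_subtype (R := K[X])
    (fun i => JordanBlockModule K (c i, e i)) (fun i => e i ≠ 0) fun i hi => by
      rw [not_not] at hi
      exact Ideal.Quotient.subsingleton_iff.2 (by simp [hi])
  exact ⟨{i // e i ≠ 0}, inferInstance, fun i => (c i, e i), fun i => i.2,
    ⟨E ≪≫ₗ DirectSum.linearEquivFunOnFintype K[X] ι _ ≪≫ₗ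
      LinearEquiv.piCongrRight (fun i => Submodule.quotEquivOfEq _ _ (hspan i)) ≪≫ₗ F⟩⟩

theorem nonempty_linearEquiv_of_polyKerDim_eq [IsAlgClosed K] {M N : Type*}
    [AddCommGroup M] [Module K M] [Module K[X] M] [IsScalarTower K K[X] M]
    [AddCommGroup N] [Module K N] [Module K[X] N] [IsScalarTower K K[X] N]
    [Module.Finite K[X] M] [Module.Finite K[X] N]
    (hM : Module.IsTorsion K[X] M) (hN : Module.IsTorsion K[X] N)
    (h : ∀ (c : K) (k : ℕ), polyKerDim K M ((X - C c) ^ k) = polyKerDim K N ((X - C c) ^ k)) :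
    Nonempty (M ≃ₗ[K[X]] N) := by
  classical
  obtain ⟨ι, _, a, ha, ⟨E⟩⟩ := exists_equiv_pi_jordanBlockModule hM
  obtain ⟨κ, _, b, hb, ⟨F⟩⟩ := exists_equiv_pi_jordanBlockModule hN
  obtain ⟨σ, hσ⟩ := exists_equiv_of_sum_min_eq a b ha hb fun c k => by
    simpa only [polyKerDim_pi_jordanBlockModule] using
      (polyKerDim_congr E _).symm.trans ((h c k).trans (polyKerDim_congr F _))
  have hspan : ∀ i, Ideal.span {(X - C (a i).1) ^ (a i).2} =
      Ideal.span {(X - C (b (σ i)).1) ^ (b (σ i)).2} := fun i => by rw [hσ]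
  exact ⟨E ≪≫ₗ LinearEquiv.piCongrRight (fun i => Submodule.quotEquivOfEq _ _ (hspan i)) ≪≫ₗ
    LinearEquiv.piCongrLeft K[X] (fun j => JordanBlockModule K (b j)) σ ≪≫ₗ F.symm⟩

theorem polyKerDim_aeval' {V : Type*} [AddCommGroup V] [Module K V] (φ : Module.End K V)
    (f : K[X]) :
    polyKerDim K (Module.AEval' φ) f = Module.finrank K (LinearMap.ker (aeval φ f)) :=
  (finrank_ker_eq_of_conj (Module.AEval'.of φ) _ _ fun v => Module.AEval.of_aeval_smul φ f v).symm

/-- Endomorphisms of a finite-dimensional space over an algebraically closed field are conjugate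
as soon as the kernels of `(φ - c) ^ k` and `(ψ - c) ^ k` always have the same dimension. -/
theorem exists_conj_of_finrank_ker_eq [IsAlgClosed K] {V : Type*} [AddCommGroup V] [Module K V]
    [FiniteDimensional K V] (φ ψ : Module.End K V)
    (h : ∀ (c : K) (k : ℕ),
      Module.finrank K (LinearMap.ker ((φ - algebraMap K _ c) ^ k)) =
        Module.finrank K (LinearMap.ker ((ψ - algebraMap K _ c) ^ k))) :
    ∃ e : V ≃ₗ[K] V, ∀ v, e (φ v) = ψ (e v) := by
  obtain ⟨E⟩ := nonempty_linearEquiv_of_polyKerDim_eq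
    (M := Module.AEval' φ) (N := Module.AEval' ψ)
    (Module.AEval.isTorsion_of_finiteDimensional K V φ)
    (Module.AEval.isTorsion_of_finiteDimensional K V ψ) fun c k => by
      have haeval : ∀ χ : Module.End K V,
          aeval χ ((X - C c) ^ k) = (χ - algebraMap K _ c) ^ k := fun χ => by simp
      rw [polyKerDim_aeval', polyKerDim_aeval', haeval, haeval, h]
  refine ⟨Module.AEval'.of φ ≪≫ₗ E.restrictScalars K ≪≫ₗ (Module.AEval'.of ψ).symm, fun v => ?_⟩
  simp only [LinearEquiv.trans_apply, LinearEquiv.restrictScalars_apply]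
  rw [← Module.AEval'.X_smul_of, map_smul, Module.AEval'.of_symm_X_smul]

end PolyKerDim

/-- An invertible complex matrix of positive size can be rescaled to have determinant one. -/
theorem exists_smul_det_eq_one {m : Type*} [Fintype m] [DecidableEq m] [Nonempty m]
    {g : Matrix m m ℂ} (hg : g.det ≠ 0) : ∃ c : ℂ, (c • g).det = 1 := by
  obtain ⟨c, hc⟩ := IsAlgClosed.exists_pow_nat_eq (g.det)⁻¹ (Fintype.card_pos (α := m))
  exact ⟨c, by rw [Matrix.det_smul, hc, inv_mul_cancel₀ hg]⟩

theorem kerDim_neg_pow {m : Type*} [Fintype m] [DecidableEq m] (Y : Matrix m m ℂ) (k : ℕ) :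
    kerDim ((-Y) ^ k) = kerDim (Y ^ k) := by
  unfold kerDim
  rcases Nat.even_or_odd k with hk | hk
  · rw [hk.neg_pow]
  · rw [hk.neg_pow, ← Matrix.toLin'_apply', map_neg, LinearMap.ker_neg, Matrix.toLin'_apply']

open Matrix in
theorem kerDim_eq_of_mul_eq_mul {m : Type*} [Fintype m] [DecidableEq m]
    {g Y Z : Matrix m m ℂ} (hg : IsUnit g.det) (h : g * Y = Z * g) : kerDim Y = kerDim Z :=
  finrank_ker_eq_of_conj
    (Matrix.toLin'OfInv (g.nonsing_inv_mul hg) (g.mul_nonsing_inv hg)) _ _ fun x => by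
      change g *ᵥ (Y *ᵥ x) = Z *ᵥ (g *ᵥ x)
      rw [Matrix.mulVec_mulVec, Matrix.mulVec_mulVec, h]

theorem exists_mul_eq_mul_of_kerDim_eq {m : Type*} [Fintype m] [DecidableEq m]
    (Y Z : Matrix m m ℂ)
    (h : ∀ (c : ℂ) (k : ℕ), kerDim ((Y - c • 1) ^ k) = kerDim ((Z - c • 1) ^ k)) :
    ∃ g : Matrix m m ℂ, g.det ≠ 0 ∧ g * Y = Z * g := by
  obtain ⟨e, he⟩ := exists_conj_of_finrank_ker_eq (Matrix.toLinAlgEquiv' Y)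
    (Matrix.toLinAlgEquiv' Z) fun c k => by
      have hmap : ∀ W : Matrix m m ℂ, (Matrix.toLinAlgEquiv' W - algebraMap ℂ _ c) ^ k =
          Matrix.toLinAlgEquiv' ((W - c • 1) ^ k) := fun W => by
        rw [map_pow, map_sub, ← Algebra.algebraMap_eq_smul_one, AlgEquiv.commutes]
      rw [hmap, hmap]
      exact h c k
  refine ⟨LinearMap.toMatrix' e, ?_, ?_⟩
  · rw [LinearMap.det_toMatrix']
    exact (LinearEquiv.isUnit_det' e).ne_zero
  · apply Matrix.toLin'.injective
    rw [Matrix.toLin'_mul, Matrix.toLin'_mul, Matrix.toLin'_toMatrix']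
    exact LinearMap.ext he

/-- a nonzero trace-zero complex matrix is Ad_{SL(n,ℂ)}-real iff for every
λ ∈ ℂ and k ∈ ℕ, dim ker (X - λ·1)^k = dim ker (X + λ·1)^k. -/
theorem adSL_real_iff_kernel_dims (n : ℕ) (hn : 1 ≤ n)
    (X : Matrix (Fin n) (Fin n) ℂ) (hX : X ≠ 0) (htr : X.trace = 0) :
    (∃ g : Matrix (Fin n) (Fin n) ℂ, g.det = 1 ∧ g * X = -X * g) ↔
      (∀ (lam : ℂ) (k : ℕ),
        kerDim ((X - lam • 1) ^ k) = kerDim ((X + lam • 1) ^ k)) := by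
  have hneg : ∀ (c : ℂ) (k : ℕ), kerDim ((-X - c • 1) ^ k) = kerDim ((X + c • 1) ^ k) :=
    fun c k => by rw [← kerDim_neg_pow, neg_sub, sub_neg_eq_add, add_comm]
  have : Nonempty (Fin n) := ⟨⟨0, hn⟩⟩
  constructor
  · rintro ⟨g, hdet, hg⟩ lam k
    rw [← hneg]
    refine kerDim_eq_of_mul_eq_mul (g := g) (by simp [hdet]) ?_
    exact SemiconjBy.pow_right (a := g) (x := X - lam • 1) (y := -X - lam • 1)
      (SemiconjBy.sub_right hg (by simp [SemiconjBy])) k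
  · intro h
    obtain ⟨g, hdet, hg⟩ := exists_mul_eq_mul_of_kerDim_eq X (-X) fun c k => by rw [h, hneg]
    obtain ⟨c, hc⟩ := exists_smul_det_eq_one hdet
    exact ⟨c • g, hc, by rw [smul_mul_assoc, hg, mul_smul_comm]⟩
end

section
/- Let n ≥ 1 and let X ∈ M(n,ℍ) be a nonzero quaternionic matrix with tr(Φ(X)) = 0 which is Ad_{SL(n,ℍ)}-real. Then X is strongly Ad_{SL(n,ℍ)}-real if and only if for every nonzero purely imaginary μ ∈ ℂ (i.e. μ.re = 0 and μ ≠ 0) and every integer d ≥ 1, the number t_d(Φ(X), μ) is even. -/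
/-- `tB Y lam d` is the number of Jordan blocks of size `d` with eigenvalue `lam`
in the Jordan form of `Y`. -/
noncomputable def tB {m : Type*} [Fintype m] [DecidableEq m]
    (Y : Matrix m m ℂ) (lam : ℂ) (d : ℕ) : ℤ :=
  2 * kerDim ((Y - lam • 1) ^ d) - kerDim ((Y - lam • 1) ^ (d - 1))
    - kerDim ((Y - lam • 1) ^ (d + 1))

namespace QuaternionicReality

local notation "conj" => starRingEnd ℂ

section Nilpotent

variable {D V : Type*} [DivisionRing D] [AddCommGroup V] [Module D V]

/-- Disjoint submodules are separated by an idempotent. -/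
theorem exists_projection_of_disjoint {C A : Submodule D V} (h : Disjoint C A) :
    ∃ q : V →ₗ[D] V, (∀ v, q v ∈ C) ∧ (∀ v ∈ C, q v = v) ∧ ∀ v ∈ A, q v = 0 := by
  obtain ⟨E, hE⟩ := Submodule.exists_isCompl (C ⊔ A)
  have hC : IsCompl C (A ⊔ E) := by
    refine ⟨h.disjoint_sup_right_of_disjoint_sup_left hE.disjoint, ?_⟩
    rw [codisjoint_iff, ← sup_assoc]
    exact hE.sup_eq_top
  refine ⟨C.subtype ∘ₗ C.projectionOnto _ hC, fun v => by simp, fun v hv => ?_, fun v hv => ?_⟩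
  · exact congrArg Subtype.val (Submodule.projectionOnto_apply_left hC ⟨v, hv⟩)
  · rw [LinearMap.comp_apply,
      Submodule.projectionOnto_apply_of_mem_right hC ((le_sup_left : A ≤ A ⊔ E) hv), map_zero]

/-- A linear map has a section over the image of any submodule. -/
theorem exists_section_map (N : V →ₗ[D] V) (B : Submodule D V) :
    ∃ s : V →ₗ[D] V, ∀ a ∈ B.map N, s a ∈ B ∧ N (s a) = a := by
  obtain ⟨g, hg⟩ := (N.submoduleMap B).exists_rightInverse_of_surjective
    (LinearMap.range_eq_top.2 (N.submoduleMap_surjective B))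
  obtain ⟨s, hs⟩ := (B.subtype ∘ₗ g).exists_extend
  refine ⟨s, fun a ha => ?_⟩
  have h1 : s a = g ⟨a, ha⟩ := LinearMap.congr_fun hs ⟨a, ha⟩
  rw [h1]
  exact ⟨(g ⟨a, ha⟩).2, congrArg Subtype.val (LinearMap.congr_fun hg ⟨a, ha⟩)⟩

/-- A Newton step turns an approximate semilinear square root of `ε` into an exact one. -/
theorem exists_extension_anticommuting [CharZero D] {θ : D →+* D} (hθ : ∀ x, θ (θ x) = x)
    {ε : ℤ} (hε : ε * ε = 1) (N : V →ₗ[D] V) {B : Submodule D V} (hB : B.map N ≤ B)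
    {σ : V →ₛₗ[θ] V}
    (hσ : ∀ v ∈ B.map N, σ v ∈ B.map N ∧ σ (σ v) = ε • v ∧ σ (N v) = -N (σ v))
    {C : Submodule D V} (hCd : Disjoint C (LinearMap.ker N ⊓ B.map N))
    (hCs : C ⊔ (LinearMap.ker N ⊓ B.map N) = LinearMap.ker N ⊓ B)
    {c : V →ₛₗ[θ] V} (hc : ∀ v ∈ C, c v ∈ C ∧ c (c v) = ε • v) :
    ∃ σ' : V →ₛₗ[θ] V, ∀ v ∈ B, σ' v ∈ B ∧ σ' (σ' v) = ε • v ∧ σ' (N v) = -N (σ' v) := by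
  have hCK : ∀ v ∈ C, N v = 0 := fun v hv =>
    ((le_sup_left.trans hCs.le : C ≤ _) hv).1
  have hCB : C ≤ B := fun v hv => ((le_sup_left.trans hCs.le : C ≤ _) hv).2
  have hCA : Disjoint C (B.map N) := by
    rw [Submodule.disjoint_def] at hCd ⊢
    exact fun v hv hv' => hCd v hv ⟨hCK v hv, hv'⟩
  obtain ⟨q, hqC, hq1, hq0⟩ := exists_projection_of_disjoint hCA
  obtain ⟨p, hpF, hp1, -⟩ :=
    exists_projection_of_disjoint (disjoint_bot_right : Disjoint (C ⊔ B.map N) ⊥)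
  obtain ⟨s, hs⟩ := exists_section_map N B
  have hqF : ∀ v ∈ C ⊔ B.map N, v - q v ∈ B.map N := by
    intro v hv
    obtain ⟨x, hx, y, hy, rfl⟩ := Submodule.mem_sup.1 hv
    rw [map_add, hq1 x hx, hq0 y hy]
    simpa using hy
  have hFB : C ⊔ B.map N ≤ B := sup_le hCB hB
  let τ : V →ₛₗ[θ] V :=
    (σ.comp (LinearMap.id - q) + c.comp q).comp p
      - (s.comp (σ.comp N) : V →ₛₗ[θ] V).comp (LinearMap.id - p)
  have hτ : ∀ v, τ v = σ (p v - q (p v)) + c (q (p v)) - s (σ (N (v - p v))) := fun v => rfl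
  have hτA : ∀ v ∈ B.map N, τ v = σ v := by
    intro v hv
    rw [hτ, hp1 v ((le_sup_right : _ ≤ C ⊔ B.map N) hv), hq0 v hv]
    simp
  have hτC : ∀ v ∈ C, τ v = c v := by
    intro v hv
    rw [hτ, hp1 v ((le_sup_left : _ ≤ C ⊔ B.map N) hv), hq1 v hv]
    simp
  have hNB : ∀ v ∈ B, N v ∈ B.map N := fun v hv => Submodule.mem_map_of_mem hv
  have hpB : ∀ v ∈ B, v - p v ∈ B := fun v hv => B.sub_mem hv (hFB (hpF v))
  have hτB : ∀ v ∈ B, τ v ∈ B := by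
    intro v hv
    rw [hτ]
    exact B.sub_mem (B.add_mem (hB (hσ _ (hqF _ (hpF v))).1) (hCB (hc _ (hqC _)).1))
      (hs _ (hσ _ (hNB _ (hpB v hv))).1).1
  have hNτ : ∀ v ∈ B, N (τ v) = -σ (N v) := by
    intro v hv
    rw [hτ, map_sub, map_add, hCK _ (hc _ (hqC _)).1,
      (hs _ (hσ _ (hNB _ (hpB v hv))).1).2]
    have h1 := (hσ _ (hqF _ (hpF v))).2.2
    rw [map_sub, hCK _ (hqC _), sub_zero] at h1
    rw [eq_neg_iff_add_eq_zero] at h1 ⊢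
    refine Eq.trans ?_ h1
    rw [map_sub N v, map_sub σ (N v)]
    abel
  let ρ : V → V := fun v => ε • τ (τ v) - v
  have hρA : ∀ v ∈ B.map N, ρ v = 0 := by
    intro v hv
    have h1 := hσ v hv
    simp only [ρ]
    rw [hτA v hv, hτA _ h1.1, h1.2.1, smul_smul, hε, one_smul, sub_self]
  have hρC : ∀ v ∈ C, ρ v = 0 := by
    intro v hv
    have h1 := hc v hv
    simp only [ρ]
    rw [hτC v hv, hτC _ h1.1, h1.2, smul_smul, hε, one_smul, sub_self]
  have hρK : ∀ v ∈ LinearMap.ker N ⊓ B, ρ v = 0 := by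
    intro v hv
    rw [← hCs] at hv
    obtain ⟨x, hx, y, hy, rfl⟩ := Submodule.mem_sup.1 hv
    have h1 := hρC x hx
    have h2 := hρA y hy.2
    simp only [ρ, map_add, smul_add] at h1 h2 ⊢
    rw [sub_eq_zero] at h1 h2
    rw [h1, h2, sub_self]
  have hρB : ∀ v ∈ B, ρ v ∈ LinearMap.ker N ⊓ B := by
    intro v hv
    refine ⟨?_, B.sub_mem (B.smul_of_tower_mem ε (hτB _ (hτB v hv))) hv⟩
    have h1 := (hσ _ (hNB v hv))
    change N (ρ v) = 0
    simp only [ρ]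
    rw [map_sub, map_zsmul, hNτ _ (hτB v hv), hNτ v hv, map_neg, neg_neg, h1.2.1, smul_smul, hε,
      one_smul, sub_self]
  have hρρ : ∀ v ∈ B, τ (τ (τ (τ v))) = (2 * ε) • τ (τ v) - v := by
    intro v hv
    have h1 := hρK _ (hρB v hv)
    simp only [ρ, map_sub, map_zsmul, smul_sub, smul_smul, hε, one_smul] at h1
    rw [two_mul, add_smul]
    rw [sub_eq_zero] at h1
    have := eq_add_of_sub_eq h1
    rw [this]
    abel
  have h2 : (2 : D) ≠ 0 := two_ne_zero
  have h2θ : θ 2⁻¹ = 2⁻¹ := by rw [map_inv₀, map_ofNat]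
  let σ' : V →ₛₗ[θ] V :=
    { toFun := fun v => (2⁻¹ : D) • ((3 : ℤ) • τ v - ε • τ (τ (τ v)))
      map_add' := fun x y => by
        simp only [map_add]
        rw [← smul_add]
        congr 1
        module
      map_smul' := fun a v => by
        have hcomm : (2⁻¹ : D) * θ a = θ a * 2⁻¹ := by
          have : Commute (2 : D) (θ a) := Nat.cast_commute 2 (θ a)
          exact this.inv_left₀
        simp only [map_smulₛₗ, hθ]
        rw [smul_comm (3 : ℤ), smul_comm ε, ← smul_sub, smul_smul, hcomm, mul_smul] }
  have hσ' : ∀ v, σ' v = (2⁻¹ : D) • ((3 : ℤ) • τ v - ε • τ (τ (τ v))) := fun v => rfl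
  refine ⟨σ', fun v hv => ⟨?_, ?_, ?_⟩⟩
  · rw [hσ']
    have h1 := hτB v hv
    exact B.smul_mem _ (B.sub_mem (B.smul_of_tower_mem (3 : ℤ) h1)
      (B.smul_of_tower_mem ε (hτB _ (hτB _ h1))))
  · have h4 := hρρ v hv
    have h6 := hρρ _ (hτB _ (hτB v hv))
    have key : (3 : ℤ) • τ ((3 : ℤ) • τ v - ε • τ (τ (τ v)))
        - ε • τ (τ (τ ((3 : ℤ) • τ v - ε • τ (τ (τ v))))) = (4 : ℤ) • ε • v := by
      simp only [map_sub, map_zsmul]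
      rw [h6, h4]
      rcases mul_self_eq_one_iff.1 hε with rfl | rfl <;> module
    rw [hσ', hσ']
    simp only [map_smulₛₗ, h2θ]
    rw [smul_comm (3 : ℤ) (2⁻¹ : D), smul_comm ε (2⁻¹ : D), ← smul_sub, key,
      ← Int.cast_smul_eq_zsmul D 4, smul_smul, smul_smul]
    convert one_smul D (ε • v)
    push_cast
    rw [show (4 : D) = 2 * 2 by norm_num, mul_assoc, ← mul_assoc (2⁻¹ : D) 2 2,
      inv_mul_cancel₀ h2, one_mul, inv_mul_cancel₀ h2]
  · have h1 := hNB v hv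
    have e1 := hσ _ h1
    have e2 := hσ _ e1.1
    have e3 : ∀ w ∈ B.map N, σ' w = σ w := by
      intro w hw
      have f1 := hσ w hw
      rw [hσ', hτA w hw, hτA _ f1.1, hτA _ (hσ _ f1.1).1, f1.2.1, map_zsmul, smul_smul, hε,
        one_smul, show (3 : ℤ) • σ w - σ w = (2 : ℤ) • σ w by abel,
        ← Int.cast_smul_eq_zsmul D 2, smul_smul]
      push_cast
      rw [inv_mul_cancel₀ h2, one_smul]
    rw [e3 _ h1, hσ', map_smul, map_sub, map_zsmul, map_zsmul, hNτ _ (hτB _ (hτB v hv)), hNτ v hv,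
      ← smul_neg]
    have key : -((3 : ℤ) • -σ (N v) - ε • -σ (N (τ (τ v)))) = (2 : ℤ) • σ (N v) := by
      rw [hNτ _ (hτB v hv), hNτ v hv]
      simp only [map_neg, neg_neg]
      rw [e1.2.1, map_zsmul]
      rcases mul_self_eq_one_iff.1 hε with rfl | rfl <;> module
    rw [key, ← Int.cast_smul_eq_zsmul D 2, smul_smul]
    push_cast
    rw [inv_mul_cancel₀ h2, one_smul]

end Nilpotent

section Chain

variable {D V : Type*} [DivisionRing D] [AddCommGroup V] [Module D V]

/-- On the kernel of a power of `N`, a semilinear square root of `ε` anticommuting with `N` exists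
as soon as one exists (without reference to `N`) on every layer of the socle filtration. -/
theorem exists_anticommuting_on_ker_pow [CharZero D] {θ : D →+* D} (hθ : ∀ x, θ (θ x) = x)
    {ε : ℤ} (hε : ε * ε = 1) (N : Module.End D V) (L : ℕ)
    (hC : ∀ (m : ℕ) (C : Submodule D V),
      Disjoint C (LinearMap.ker N ⊓ (LinearMap.ker (N ^ L)).map (N ^ (m + 1))) →
      C ⊔ (LinearMap.ker N ⊓ (LinearMap.ker (N ^ L)).map (N ^ (m + 1))) =
        LinearMap.ker N ⊓ (LinearMap.ker (N ^ L)).map (N ^ m) →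
      ∃ c : V →ₛₗ[θ] V, ∀ v ∈ C, c v ∈ C ∧ c (c v) = ε • v) :
    ∃ σ : V →ₛₗ[θ] V, ∀ v ∈ LinearMap.ker (N ^ L),
      σ v ∈ LinearMap.ker (N ^ L) ∧ σ (σ v) = ε • v ∧ σ (N v) = -N (σ v) := by
  set M := LinearMap.ker (N ^ L)
  have hmap : ∀ m, (M.map (N ^ m)).map N = M.map (N ^ (m + 1)) := fun m => by
    rw [← Submodule.map_comp, pow_succ']; rfl
  have hle : ∀ m, (M.map (N ^ m)).map N ≤ M.map (N ^ m) := fun m => by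
    rw [hmap, pow_succ, Module.End.mul_eq_comp, Submodule.map_comp]
    apply Submodule.map_mono
    rintro _ ⟨v, hv, rfl⟩
    change (N ^ L) (N v) = 0
    change (N ^ L) v = 0 at hv
    rw [← Module.End.mul_apply, ← pow_succ, pow_succ', Module.End.mul_apply, hv, map_zero]
  have main : ∀ j m, m + j = L → ∃ σ : V →ₛₗ[θ] V, ∀ v ∈ M.map (N ^ m),
      σ v ∈ M.map (N ^ m) ∧ σ (σ v) = ε • v ∧ σ (N v) = -N (σ v) := by
    intro j
    induction j with
    | zero =>
      rintro m rfl
      refine ⟨0, ?_⟩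
      rintro _ ⟨v, hv, rfl⟩
      have h0 : (N ^ m) v = 0 := hv
      simp [h0]
    | succ j ih =>
      intro m hm
      obtain ⟨σ, hσ⟩ := ih (m + 1) (by omega)
      obtain ⟨C, hCd, hCs⟩ := IsModularLattice.exists_disjoint_and_sup_eq
        (inf_le_inf_left (LinearMap.ker N) ((hmap m).symm.trans_le (hle m)))
      rw [sup_comm] at hCs
      obtain ⟨c, hc⟩ := hC m C hCd.symm hCs
      rw [← hmap] at hσ hCd hCs
      exact exists_extension_anticommuting hθ hε N (hle m) hσ hCd.symm hCs hc
  simpa [Module.End.one_eq_id] using main L 0 (zero_add L)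

/-- The layers of the socle filtration measure the growth of the kernels of powers. -/
theorem finrank_layer [FiniteDimensional D V] (N : Module.End D V) {L : ℕ}
    (hL : ∀ m, LinearMap.ker (N ^ m) ≤ LinearMap.ker (N ^ L)) (m : ℕ) :
    Module.finrank D ↥(LinearMap.ker N ⊓ (LinearMap.ker (N ^ L)).map (N ^ m)) +
      Module.finrank D (LinearMap.ker (N ^ m)) = Module.finrank D (LinearMap.ker (N ^ (m + 1))) := by
  have h1 : LinearMap.ker N ⊓ (LinearMap.ker (N ^ L)).map (N ^ m) =
      LinearMap.range ((N ^ m).domRestrict (LinearMap.ker (N ^ (m + 1)))) := by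
    rw [LinearMap.range_domRestrict]
    ext v
    constructor
    · rintro ⟨h1, w, hw, rfl⟩
      refine ⟨w, ?_, rfl⟩
      change (N ^ (m + 1)) w = 0
      rw [pow_succ', Module.End.mul_apply]
      exact h1
    · rintro ⟨w, hw, rfl⟩
      refine ⟨?_, w, hL _ hw, rfl⟩
      change N ((N ^ m) w) = 0
      rw [← Module.End.mul_apply, ← pow_succ']
      exact hw
  have h2 : LinearMap.ker (N ^ m) ≤ LinearMap.ker (N ^ (m + 1)) := by
    intro v hv
    change (N ^ m) v = 0 at hv
    change (N ^ (m + 1)) v = 0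
    rw [pow_succ', Module.End.mul_apply, hv, map_zero]
  rw [h1, ← LinearMap.finrank_range_add_finrank_ker
    ((N ^ m).domRestrict (LinearMap.ker (N ^ (m + 1)))), LinearMap.ker_domRestrict,
    (Submodule.comapSubtypeEquivOfLe h2).finrank_eq]

/-- A complement of one layer in the previous one counts Jordan blocks of a given size. -/
theorem finrank_layer_complement [FiniteDimensional D V] (N : Module.End D V) {L : ℕ}
    (hL : ∀ m, LinearMap.ker (N ^ m) ≤ LinearMap.ker (N ^ L)) (m : ℕ) {C : Submodule D V}
    (hd : Disjoint C (LinearMap.ker N ⊓ (LinearMap.ker (N ^ L)).map (N ^ (m + 1))))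
    (hs : C ⊔ (LinearMap.ker N ⊓ (LinearMap.ker (N ^ L)).map (N ^ (m + 1))) =
        LinearMap.ker N ⊓ (LinearMap.ker (N ^ L)).map (N ^ m)) :
    (Module.finrank D C : ℤ) = 2 * Module.finrank D (LinearMap.ker (N ^ (m + 1)))
      - Module.finrank D (LinearMap.ker (N ^ m))
      - Module.finrank D (LinearMap.ker (N ^ (m + 2))) := by
  have h1 := finrank_layer N hL m
  have h2 := finrank_layer N hL (m + 1)
  have h3 := Submodule.finrank_sup_add_finrank_inf_eq C
    (LinearMap.ker N ⊓ (LinearMap.ker (N ^ L)).map (N ^ (m + 1)))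
  rw [hs, hd.eq_bot, finrank_bot] at h3
  rw [show m + 1 + 1 = m + 2 from rfl] at h2
  omega

end Chain

section Antilinear

variable {V : Type*} [AddCommGroup V] [Module ℂ V]

/-- A space with a quaternionic structure has even complex dimension. -/
theorem even_finrank_of_antilinear [FiniteDimensional ℂ V] (J : V →ₛₗ[conj] V)
    (S : Submodule ℂ V) (hS : ∀ v ∈ S, J v ∈ S) (hJ : ∀ v ∈ S, J (J v) = -v) :
    Even (Module.finrank ℂ S) := by
  let b := Module.finBasis ℂ S
  let K : S → S := fun v => ⟨J v, hS v v.2⟩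
  let A : Matrix (Fin (Module.finrank ℂ S)) (Fin (Module.finrank ℂ S)) ℂ :=
    Matrix.of fun i j => b.repr (K (b j)) i
  have hA : ∀ j, J (b j) = ∑ i, A i j • (b i : V) := by
    intro j
    have h := congrArg Subtype.val (b.sum_repr (K (b j)))
    rw [Submodule.coe_sum] at h
    exact h.symm
  have hAA : A * A.map conj = -1 := by
    ext i j
    have h1 : (∑ i, (A * A.map conj) i j • (b i : V)) = -(b j : V) := by
      rw [← hJ _ (b j).2, hA j, map_sum]
      simp only [map_smulₛₗ, hA, Matrix.mul_apply, Matrix.map_apply, Finset.sum_smul,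
        Finset.smul_sum, smul_smul]
      rw [Finset.sum_comm]
      simp only [mul_comm]
    have h2 : (∑ i, (A * A.map conj) i j • b i) = - b j := by
      apply Subtype.ext
      simpa using h1
    have h3 := congrArg (fun v => b.repr v i) h2
    rw [b.repr_sum_self] at h3
    rw [h3]
    simp [Finsupp.single_apply, Matrix.one_apply, eq_comm]
  have hdet := congrArg Matrix.det hAA
  rw [Matrix.det_mul, Matrix.det_neg, Matrix.det_one, mul_one, Fintype.card_fin,
    ← RingHom.mapMatrix_apply, ← RingHom.map_det, Complex.mul_conj] at hdet
  by_contra hodd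
  rw [(Nat.not_even_iff_odd.1 hodd).neg_one_pow] at hdet
  have := congrArg Complex.re hdet
  have h0 := Complex.normSq_nonneg A.det
  simp at this
  linarith

/-- A complex space of even dimension has a quaternionic structure. -/
theorem exists_antilinear_of_even_finrank [FiniteDimensional ℂ V] (C : Submodule ℂ V)
    (hC : Even (Module.finrank ℂ C)) :
    ∃ c : V →ₛₗ[conj] V, ∀ v ∈ C, c v ∈ C ∧ c (c v) = (-1 : ℤ) • v := by
  obtain ⟨k, hk⟩ := hC
  obtain ⟨E, hE⟩ := Submodule.exists_isCompl C
  let e : C ≃ₗ[ℂ] (Fin k ⊕ Fin k → ℂ) :=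
    ((Module.finBasis ℂ C).reindex ((finCongr hk).trans finSumFinEquiv.symm)).equivFun
  let c₀ : (Fin k ⊕ Fin k → ℂ) →ₛₗ[conj] (Fin k ⊕ Fin k → ℂ) :=
    { toFun := fun x => Sum.elim (fun i => -conj (x (Sum.inr i))) (fun i => conj (x (Sum.inl i)))
      map_add' := fun x y => by ext (i | i) <;> simp [add_comm]
      map_smul' := fun a x => by ext (i | i) <;> simp }
  have hc₀ : ∀ x, c₀ (c₀ x) = -x := fun x => by ext (i | i) <;> simp [c₀]
  let p : V →ₗ[ℂ] C := C.projectionOnto E hE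
  have hp : ∀ v : C, p v = v := Submodule.projectionOnto_apply_left hE
  refine ⟨(C.subtype ∘ₗ e.symm.toLinearMap).comp (c₀.comp (e.toLinearMap ∘ₗ p)), fun v hv => ?_⟩
  have h1 : p v = ⟨v, hv⟩ := hp ⟨v, hv⟩
  constructor
  · simp
  · simp [hp, h1, hc₀]

end Antilinear

section Assembly

variable {V : Type*} [AddCommGroup V] [Module ℂ V]

theorem map_mem_ker_pow (T : Module.End ℂ V) {lam lam' c : ℂ} (S : V → V)
    (hS : ∀ v, T (S v) - lam' • S v = S (c • (T v - lam • v))) (hS0 : S 0 = 0) (k : ℕ) {v : V}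
    (hv : v ∈ LinearMap.ker ((T - lam • 1) ^ k)) : S v ∈ LinearMap.ker ((T - lam' • 1) ^ k) := by
  rw [LinearMap.mem_ker] at hv ⊢
  induction k generalizing v with
  | zero =>
    have : v = 0 := hv
    rw [this, hS0, map_zero]
  | succ k ih =>
    rw [pow_succ, Module.End.mul_apply] at hv ⊢
    have h1 : (T - lam' • 1) (S v) = S (c • (T v - lam • v)) := hS v
    rw [h1]
    apply ih
    rw [map_smul]
    have h2 : (T - lam • 1) v = T v - lam • v := rfl
    rw [← h2, hv, smul_zero]

/-- A map intertwining `T - lam'` and a multiple of `T - lam` maps generalized eigenvectors to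
generalized eigenvectors. -/
theorem map_mem_maxGenEigenspace (T : Module.End ℂ V) {lam lam' c : ℂ} (S : V → V)
    (hS : ∀ v, T (S v) - lam' • S v = S (c • (T v - lam • v))) (hS0 : S 0 = 0) {v : V}
    (hv : v ∈ T.maxGenEigenspace lam) : S v ∈ T.maxGenEigenspace lam' := by
  rw [Module.End.mem_maxGenEigenspace] at hv ⊢
  obtain ⟨k, hk⟩ := hv
  exact ⟨k, map_mem_ker_pow T S hS hS0 k hk⟩

theorem maxGenEigenspace_eq_ker_pow [FiniteDimensional ℂ V] (T : Module.End ℂ V) (μ : ℂ) :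
    T.maxGenEigenspace μ = LinearMap.ker ((T - μ • 1) ^ Module.finrank ℂ V) := by
  rw [Module.End.maxGenEigenspace_eq_genEigenspace_finrank, Module.End.genEigenspace_nat]

theorem exists_antilinear_on_maxGenEigenspace [FiniteDimensional ℂ V] (T : Module.End ℂ V) (μ : ℂ)
    (heven : ∀ m : ℕ, Even (2 * Module.finrank ℂ (LinearMap.ker ((T - μ • 1) ^ (m + 1)))
      - Module.finrank ℂ (LinearMap.ker ((T - μ • 1) ^ m))
      - Module.finrank ℂ (LinearMap.ker ((T - μ • 1) ^ (m + 2))) : ℤ)) :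
    ∃ σ : V →ₛₗ[conj] V, ∀ v ∈ T.maxGenEigenspace μ, σ v ∈ T.maxGenEigenspace μ ∧
      σ (σ v) = -v ∧ σ (T v - μ • v) = -(T (σ v) - μ • σ v) := by
  obtain ⟨σ, hσ⟩ := exists_anticommuting_on_ker_pow (θ := conj) Complex.conj_conj
    (ε := -1) (by norm_num) (T - μ • 1) (Module.finrank ℂ V) (fun m C hd hs => by
      apply exists_antilinear_of_even_finrank
      rw [← Int.even_coe_nat, finrank_layer_complement (T - μ • 1)
        (Module.End.ker_pow_le_ker_pow_finrank _) m hd hs]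
      exact heven m)
  refine ⟨σ, fun v hv => ?_⟩
  rw [maxGenEigenspace_eq_ker_pow] at hv ⊢
  obtain ⟨h1, h2, h3⟩ := hσ v hv
  exact ⟨h1, by rw [h2, neg_smul, one_smul], h3⟩

/-- Linear maps given on the generalized eigenspaces can be glued. -/
theorem exists_glue [FiniteDimensional ℂ V] (T : Module.End ℂ V) (f : ℂ → Module.End ℂ V) :
    ∃ G : Module.End ℂ V, ∀ lam, ∀ v ∈ T.maxGenEigenspace lam, G v = f lam v := by
  classical
  have hint : DirectSum.IsInternal T.maxGenEigenspace :=
    DirectSum.isInternal_submodule_of_iSupIndep_of_iSup_eq_top T.independent_maxGenEigenspace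
      T.iSup_maxGenEigenspace_eq_top
  let e := LinearEquiv.ofBijective (DirectSum.coeLinearMap T.maxGenEigenspace) hint
  refine ⟨(DirectSum.toModule ℂ ℂ V fun lam => (f lam) ∘ₗ (T.maxGenEigenspace lam).subtype) ∘ₗ
    e.symm.toLinearMap, fun lam v hv => ?_⟩
  have h1 : e.symm v = DirectSum.lof ℂ ℂ (fun lam => T.maxGenEigenspace lam) lam ⟨v, hv⟩ := by
    rw [LinearEquiv.symm_apply_eq]
    exact (DirectSum.coeLinearMap_lof T.maxGenEigenspace lam ⟨v, hv⟩).symm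
  change DirectSum.toModule ℂ ℂ V _ (e.symm v) = _
  rw [h1, DirectSum.toModule_lof]
  rfl

/-- Additive maps agreeing on all generalized eigenspaces agree. -/
theorem eq_of_eqOn_maxGenEigenspace [FiniteDimensional ℂ V] (T : Module.End ℂ V) {A B : V →+ V}
    (h : ∀ lam, ∀ v ∈ T.maxGenEigenspace lam, A v = B v) (v : V) : A v = B v := by
  have hv : v ∈ ⨆ lam, T.maxGenEigenspace lam := by
    rw [T.iSup_maxGenEigenspace_eq_top]; trivial
  induction hv using Submodule.iSup_induction' with
  | mem i x hx => exact h i x hx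
  | zero => rw [map_zero, map_zero]
  | add x y _ _ hx hy => rw [map_add, map_add, hx, hy]

/-- Gluing a compatible family of local involutions. -/
theorem exists_involution_of_local [FiniteDimensional ℂ V] (T : Module.End ℂ V) (J : V →ₛₗ[conj] V)
    (hJT : ∀ v, J (T v) = T (J v)) (f : ℂ → Module.End ℂ V)
    (hf : ∀ lam, ∀ v ∈ T.maxGenEigenspace lam, f lam v ∈ T.maxGenEigenspace (-lam) ∧
      f (-lam) (f lam v) = v ∧ f lam (T v) = -T (f lam v) ∧ f (conj lam) (J v) = J (f lam v)) :
    ∃ G : Module.End ℂ V, (∀ v, G (G v) = v) ∧ (∀ v, G (T v) = -T (G v)) ∧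
      ∀ v, G (J v) = J (G v) := by
  obtain ⟨G, hG⟩ := exists_glue T f
  refine ⟨G, ?_, ?_, ?_⟩
  · refine eq_of_eqOn_maxGenEigenspace T (A := (G ∘ₗ G).toAddMonoidHom) (B := AddMonoidHom.id V)
      fun lam v hv => ?_
    obtain ⟨h1, h2, -⟩ := hf lam v hv
    change G (G v) = v
    rw [hG lam v hv, hG _ _ h1, h2]
  · refine eq_of_eqOn_maxGenEigenspace T (A := (G ∘ₗ T).toAddMonoidHom)
      (B := (-(T ∘ₗ G)).toAddMonoidHom) fun lam v hv => ?_
    change G (T v) = -T (G v)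
    rw [hG lam v hv, hG lam _ (T.mapsTo_maxGenEigenspace_of_comm (Commute.refl T) lam hv)]
    exact (hf lam v hv).2.2.1
  · refine eq_of_eqOn_maxGenEigenspace T (A := (G.comp J).toAddMonoidHom)
      (B := (J.comp G).toAddMonoidHom) fun lam v hv => ?_
    change G (J v) = J (G v)
    have hJv : J v ∈ T.maxGenEigenspace (conj lam) :=
      map_mem_maxGenEigenspace T (c := 1) J
        (fun v => by rw [one_smul, map_sub, hJT, map_smulₛₗ]) (map_zero J) hv
    rw [hG lam v hv, hG _ _ hJv]
    exact (hf lam v hv).2.2.2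

/-- If `T` is reversed by an invertible `J`-linear map and its purely imaginary nonzero Jordan
blocks have even multiplicities, then `T` is reversed by a `J`-linear involution. -/
theorem exists_involution_of_even [FiniteDimensional ℂ V] (T h h' g₀ : Module.End ℂ V)
    (J : V →ₛₗ[conj] V) (hJ : ∀ v, J (J v) = -v) (hJT : ∀ v, J (T v) = T (J v))
    (hhh' : ∀ v, h (h' v) = v) (hh'h : ∀ v, h' (h v) = v) (hhT : ∀ v, h (T v) = -T (h v))
    (hhJ : ∀ v, h (J v) = J (h v))
    (hg₀ : ∀ v ∈ T.maxGenEigenspace 0, g₀ v ∈ T.maxGenEigenspace 0 ∧ g₀ (g₀ v) = v ∧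
      g₀ (T v) = -T (g₀ v) ∧ g₀ (J v) = J (g₀ v))
    (heven : ∀ μ : ℂ, μ.re = 0 → μ ≠ 0 → ∀ m : ℕ,
      Even (2 * Module.finrank ℂ (LinearMap.ker ((T - μ • 1) ^ (m + 1)))
      - Module.finrank ℂ (LinearMap.ker ((T - μ • 1) ^ m))
      - Module.finrank ℂ (LinearMap.ker ((T - μ • 1) ^ (m + 2))) : ℤ)) :
    ∃ G : Module.End ℂ V, (∀ v, G (G v) = v) ∧ (∀ v, G (T v) = -T (G v)) ∧
      ∀ v, G (J v) = J (G v) := by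
  have hσ : ∀ μ : ℂ, ∃ σ : V →ₛₗ[conj] V, μ.re = 0 → μ ≠ 0 → ∀ v ∈ T.maxGenEigenspace μ,
      σ v ∈ T.maxGenEigenspace μ ∧ σ (σ v) = -v ∧ σ (T v) = -T (σ v) := by
    intro μ
    by_cases hμ : μ.re = 0 ∧ μ ≠ 0
    · obtain ⟨σ, hσ⟩ := exists_antilinear_on_maxGenEigenspace T μ (heven μ hμ.1 hμ.2)
      refine ⟨σ, fun _ _ v hv => ?_⟩
      obtain ⟨h1, h2, h3⟩ := hσ v hv
      refine ⟨h1, h2, ?_⟩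
      have hc : conj μ = -μ := by apply Complex.ext <;> simp [hμ.1]
      rw [map_sub, map_smulₛₗ, hc] at h3
      have h4 := eq_add_of_sub_eq h3
      rw [h4]
      module
    · exact ⟨0, fun h1 h2 => absurd ⟨h1, h2⟩ hμ⟩
  choose σ hσ using hσ
  have hh'T : ∀ v, h' (T v) = -T (h' v) := fun v => by
    rw [← hh'h (-T (h' v)), map_neg, hhT, neg_neg, hhh']
  have hh'J : ∀ v, h' (J v) = J (h' v) := fun v => by
    rw [← hh'h (J (h' v)), hhJ, hhh']
  have hJmem : ∀ {lam v}, v ∈ T.maxGenEigenspace lam → J v ∈ T.maxGenEigenspace (conj lam) :=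
    fun {lam v} hv => map_mem_maxGenEigenspace T (c := 1) J
        (fun v => by rw [one_smul, map_sub, hJT, map_smulₛₗ]) (map_zero J) hv
  have hneg : ∀ S : Module.End ℂ V, (∀ v, S (T v) = -T (S v)) → ∀ {lam v},
      v ∈ T.maxGenEigenspace lam → S v ∈ T.maxGenEigenspace (-lam) := fun S hS {lam v} hv =>
    map_mem_maxGenEigenspace T (c := -1) S
        (fun v => by rw [map_smul, map_sub, hS, map_smul]; module) (map_zero S) hv
  let f : ℂ → Module.End ℂ V := fun lam =>
    if 0 < lam.re then h else if lam.re < 0 then h' else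
    if 0 < lam.im then -(J.comp (σ lam)) else if lam.im < 0 then -((σ (-lam)).comp J) else g₀
  refine exists_involution_of_local T J hJT f fun lam v hv => ?_
  rcases lt_trichotomy lam.re 0 with hre | hre | hre
  · have f1 : f lam = h' := by simp [f, hre, hre.le]
    have f2 : f (-lam) = h := by simp [f, hre]
    have f3 : f (conj lam) = h' := by simp [f, hre, hre.le]
    rw [f1, f2, f3]
    exact ⟨hneg h' hh'T hv, hhh' v, hh'T v, hh'J v⟩
  · have hcl : conj lam = -lam := by apply Complex.ext <;> simp [hre]
    rw [hcl]
    have hJv := hJmem hv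
    rw [hcl] at hJv
    rcases lt_trichotomy lam.im 0 with him | him | him
    · have f1 : f lam = -((σ (-lam)).comp J) := by simp [f, hre, him, him.le]
      have f2 : f (-lam) = -(J.comp (σ (-lam))) := by simp [f, hre, him]
      obtain ⟨h1, h2, h3⟩ := hσ (-lam) (by simp [hre]) (by rintro h; simp at h; simp [h] at him)
        _ hJv
      rw [f1, f2]
      simp only [LinearMap.neg_apply, LinearMap.comp_apply, map_neg, neg_neg]
      refine ⟨neg_mem h1, by rw [h2, map_neg, hJ, neg_neg], ?_, trivial⟩
      rw [hJT, h3, neg_neg]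
    · have h0 : lam = 0 := Complex.ext hre him
      subst h0
      have f1 : f 0 = g₀ := by simp [f]
      rw [neg_zero, f1]
      exact hg₀ v hv
    · have f1 : f lam = -(J.comp (σ lam)) := by simp [f, hre, him]
      have f2 : f (-lam) = -((σ lam).comp J) := by simp [f, hre, him, him.le]
      obtain ⟨h1, h2, h3⟩ := hσ lam hre (by rintro h; simp [h] at him) v hv
      have hJσ := hJmem h1
      rw [hcl] at hJσ
      rw [f1, f2]
      simp only [LinearMap.neg_apply, LinearMap.comp_apply, map_neg, neg_neg, hJ, h2, h3, hJT]
      exact ⟨neg_mem hJσ, trivial, trivial, trivial⟩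
  · have f1 : f lam = h := by simp [f, hre]
    have f2 : f (-lam) = h' := by simp [f, hre, hre.le]
    have f3 : f (conj lam) = h := by simp [f, hre]
    rw [f1, f2, f3]
    exact ⟨hneg h hhT hv, hh'h v, hhT v, hhJ v⟩

end Assembly

section RowAction

noncomputable instance complexModule : Module ℂ (Quaternion ℝ) :=
  Module.compHom _ Quaternion.ofComplex.toRingHom

theorem complex_smul_eq (z : ℂ) (q : Quaternion ℝ) : z • q = (z : Quaternion ℝ) * q := rfl

instance : IsScalarTower ℂ (Quaternion ℝ) (Quaternion ℝ) :=
  ⟨fun z p q => by simp only [complex_smul_eq, smul_eq_mul, mul_assoc]⟩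

/-- The first complex coordinate of a quaternion `a + b j`. -/
noncomputable def fstC : Quaternion ℝ →ₗ[ℂ] ℂ where
  toFun q := ⟨q.re, q.imI⟩
  map_add' p q := by apply Complex.ext <;> simp
  map_smul' z q := by apply Complex.ext <;> simp [complex_smul_eq]

/-- The second complex coordinate of a quaternion `a + b j`. -/
noncomputable def sndC : Quaternion ℝ →ₗ[ℂ] ℂ where
  toFun q := ⟨q.imJ, q.imK⟩
  map_add' p q := by apply Complex.ext <;> simp
  map_smul' z q := by apply Complex.ext <;> simp [complex_smul_eq]

theorem fstC_mul (p q : Quaternion ℝ) :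
    fstC (p * q) = fstC p * fstC q - sndC p * conj (sndC q) := by
  apply Complex.ext <;> simp [fstC, sndC] <;> ring

theorem sndC_mul (p q : Quaternion ℝ) :
    sndC (p * q) = fstC p * sndC q + sndC p * conj (fstC q) := by
  apply Complex.ext <;> simp [fstC, sndC] <;> ring

/-- The quaternion unit `j`. -/
def unitJ : Quaternion ℝ := ⟨0, 0, 1, 0⟩

theorem re_unitJ : unitJ.re = 0 := rfl
theorem imI_unitJ : unitJ.imI = 0 := rfl
theorem imJ_unitJ : unitJ.imJ = 1 := rfl
theorem imK_unitJ : unitJ.imK = 0 := rfl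

theorem unitJ_mul_unitJ_mul (q : Quaternion ℝ) : unitJ * (unitJ * q) = -q := by
  ext <;> simp [re_unitJ, imI_unitJ, imJ_unitJ, imK_unitJ]

theorem unitJ_mul_smul (z : ℂ) (q : Quaternion ℝ) : unitJ * (z • q) = conj z • (unitJ * q) := by
  ext <;> simp [complex_smul_eq, re_unitJ, imI_unitJ, imJ_unitJ, imK_unitJ] <;> ring

theorem eq_fstC_add_sndC_mul_unitJ (q : Quaternion ℝ) :
    q = (fstC q : Quaternion ℝ) + (sndC q : Quaternion ℝ) * unitJ := by
  ext <;> simp [fstC, sndC, re_unitJ, imI_unitJ, imJ_unitJ, imK_unitJ]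

variable {m : Type*}

/-- Left multiplication by `j` on row vectors. -/
noncomputable def leftJ (m : Type*) : (m → Quaternion ℝ) →ₛₗ[conj] (m → Quaternion ℝ) where
  toFun x := unitJ • x
  map_add' x y := smul_add _ x y
  map_smul' z x := funext fun k => unitJ_mul_smul z (x k)

theorem leftJ_leftJ (x : m → Quaternion ℝ) : leftJ m (leftJ m x) = -x :=
  funext fun k => unitJ_mul_unitJ_mul (x k)

/-- The complex coordinates of a quaternionic row vector. -/
noncomputable def rowCoord (m : Type*) : (m → Quaternion ℝ) ≃ₗ[ℂ] (m ⊕ m → ℂ) where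
  toFun x := Sum.elim (fun k => fstC (x k)) (fun k => sndC (x k))
  map_add' x y := by ext (k | k) <;> simp
  map_smul' z x := by ext (k | k) <;> simp
  invFun y k := ⟨(y (Sum.inl k)).re, (y (Sum.inl k)).im, (y (Sum.inr k)).re, (y (Sum.inr k)).im⟩
  left_inv x := by ext k <;> simp [fstC, sndC]
  right_inv y := by ext (k | k) <;> simp [fstC, sndC]

theorem rowCoord_inl (x : m → Quaternion ℝ) (k : m) : rowCoord m x (Sum.inl k) = fstC (x k) := rfl

theorem rowCoord_inr (x : m → Quaternion ℝ) (k : m) : rowCoord m x (Sum.inr k) = sndC (x k) := rfl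

instance [Finite m] : FiniteDimensional ℂ (m → Quaternion ℝ) :=
  (rowCoord m).symm.finiteDimensional

variable [Fintype m]

/-- A quaternionic matrix acting on row vectors, as a complex linear map. -/
noncomputable def rowAct (A : Matrix m m (Quaternion ℝ)) : Module.End ℂ (m → Quaternion ℝ) where
  toFun x := Matrix.vecMul x A
  map_add' x y := Matrix.add_vecMul A x y
  map_smul' z x := Matrix.smul_vecMul z x A

theorem rowAct_apply (A : Matrix m m (Quaternion ℝ)) (x : m → Quaternion ℝ) :
    rowAct A x = Matrix.vecMul x A := rfl

theorem rowAct_rowAct (A B : Matrix m m (Quaternion ℝ)) (x : m → Quaternion ℝ) :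
    rowAct B (rowAct A x) = rowAct (A * B) x := by
  simp only [rowAct_apply, Matrix.vecMul_vecMul]

theorem rowAct_smul (A : Matrix m m (Quaternion ℝ)) (q : Quaternion ℝ) (x : m → Quaternion ℝ) :
    rowAct A (q • x) = q • rowAct A x := Matrix.smul_vecMul q x A

theorem leftJ_rowAct (A : Matrix m m (Quaternion ℝ)) (x : m → Quaternion ℝ) :
    leftJ m (rowAct A x) = rowAct A (leftJ m x) := (rowAct_smul A unitJ x).symm

theorem kerDim_transpose (Y : Matrix m m ℂ) : kerDim Y.transpose = kerDim Y := by
  have h1 := LinearMap.finrank_range_add_finrank_ker Y.mulVecLin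
  have h2 := LinearMap.finrank_range_add_finrank_ker Y.transpose.mulVecLin
  have h3 : Y.transpose.rank = Y.rank := Matrix.rank_transpose Y
  unfold Matrix.rank at h3
  unfold kerDim
  omega

variable [DecidableEq m]

theorem rowAct_injective {A B : Matrix m m (Quaternion ℝ)} (h : ∀ x, rowAct A x = rowAct B x) :
    A = B := by
  ext1 i j
  simpa [rowAct_apply] using congrFun (h (Pi.single i 1)) j

theorem rowCoord_rowAct (A : Matrix m m (Quaternion ℝ)) (x : m → Quaternion ℝ) :
    rowCoord m (rowAct A x) = Matrix.vecMul (rowCoord m x) (Phi A) := by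
  ext (l | l)
  · change fstC (∑ k, x k * A k l) = _
    simp only [map_sum, fstC_mul, Matrix.vecMul, dotProduct, Fintype.sum_sum_type,
      sub_eq_add_neg, Finset.sum_add_distrib]
    simp [rowCoord_inl, rowCoord_inr, Phi, fstC, sndC]
  · change sndC (∑ k, x k * A k l) = _
    simp only [map_sum, sndC_mul, Matrix.vecMul, dotProduct, Fintype.sum_sum_type,
      Finset.sum_add_distrib]
    simp [rowCoord_inl, rowCoord_inr, Phi, fstC, sndC]

theorem rowCoord_pow (A : Matrix m m (Quaternion ℝ)) (μ : ℂ) (d : ℕ) (x : m → Quaternion ℝ) :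
    rowCoord m (((rowAct A - μ • 1) ^ d) x) =
      Matrix.vecMul (rowCoord m x) ((Phi A - μ • 1) ^ d) := by
  induction d generalizing x with
  | zero => simp
  | succ d ih =>
    rw [pow_succ, Module.End.mul_apply, ih, pow_succ', ← Matrix.vecMul_vecMul]
    congr 1
    simp [rowCoord_rowAct, Matrix.vecMul_sub, Matrix.vecMul_smul]

theorem finrank_ker_rowAct_pow (A : Matrix m m (Quaternion ℝ)) (μ : ℂ) (d : ℕ) :
    Module.finrank ℂ (LinearMap.ker ((rowAct A - μ • 1) ^ d)) = kerDim ((Phi A - μ • 1) ^ d) := by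
  rw [← kerDim_transpose, kerDim, ← LinearEquiv.finrank_map_eq (rowCoord m)]
  congr 2
  all_goals
  ext y
  rw [LinearMap.mem_ker, Matrix.mulVecLin_apply, Matrix.mulVec_transpose, Submodule.mem_map_equiv,
    LinearMap.mem_ker, ← (rowCoord m).map_eq_zero_iff, rowCoord_pow, LinearEquiv.apply_symm_apply]

theorem det_rowAct (A : Matrix m m (Quaternion ℝ)) : LinearMap.det (rowAct A) = (Phi A).det := by
  rw [← Matrix.det_transpose, ← LinearMap.det_toLin', ← LinearMap.det_conj _ (rowCoord m)]
  congr 1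
  refine LinearMap.ext fun y => ?_
  rw [LinearMap.comp_apply, LinearMap.comp_apply, Matrix.toLin'_apply, Matrix.mulVec_transpose]
  exact (rowCoord_rowAct A _).trans (by simp)

/-- Quaternionic involutions have determinant one. -/
theorem det_Phi_of_mul_self_eq_one {g : Matrix m m (Quaternion ℝ)} (hg : g * g = 1) :
    (Phi g).det = 1 := by
  have hgg : ∀ x, rowAct g (rowAct g x) = x := fun x => by
    rw [rowAct_rowAct, hg, rowAct_apply, Matrix.vecMul_one]
  set W := LinearMap.ker (rowAct g + 1)
  have hmem : ∀ x, x ∈ W ↔ rowAct g x = -x := fun x => eq_neg_iff_add_eq_zero.symm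
  have hWg : W ≤ W.comap (rowAct g) := fun x hx => by
    rw [Submodule.mem_comap, (hmem x).1 hx]
    exact W.neg_mem hx
  have heven : Even (Module.finrank ℂ W) := by
    refine even_finrank_of_antilinear (leftJ m) W (fun v hv => ?_) fun v _ => leftJ_leftJ v
    rw [hmem] at hv ⊢
    rw [← leftJ_rowAct, hv, map_neg]
  rw [← det_rowAct, LinearMap.det_eq_det_mul_det W _ hWg]
  have h1 : (rowAct g).restrict hWg = -LinearMap.id := by
    ext1 x
    exact Subtype.ext ((hmem x).1 x.2)
  have h2 : W.mapQ W (rowAct g) hWg = LinearMap.id := by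
    apply Submodule.linearMap_qext
    refine LinearMap.ext fun x => ?_
    rw [LinearMap.comp_apply, Submodule.mkQ_apply, Submodule.mapQ_apply, LinearMap.id_comp,
      Submodule.mkQ_apply, Submodule.Quotient.eq, hmem, map_sub, hgg, neg_sub]
  rw [h1, h2, LinearMap.det_id, mul_one, ← neg_one_smul ℂ (LinearMap.id : W →ₗ[ℂ] W),
    LinearMap.det_smul, LinearMap.det_id, mul_one, heven.neg_one_pow]

end RowAction

section Reality

variable {m : Type*} [Fintype m] [DecidableEq m]

/-- A complex linear map commuting with `j` is given by a quaternionic matrix. -/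
theorem exists_rowAct_eq (G : Module.End ℂ (m → Quaternion ℝ))
    (hG : ∀ x, G (leftJ m x) = leftJ m (G x)) :
    ∃ g : Matrix m m (Quaternion ℝ), ∀ x, rowAct g x = G x := by
  have hq : ∀ (q : Quaternion ℝ) (x : m → Quaternion ℝ),
      q • x = fstC q • x + sndC q • leftJ m x := fun q x => funext fun k => by
    change q * x k = (fstC q : Quaternion ℝ) * x k + (sndC q : Quaternion ℝ) * (unitJ * x k)
    rw [← mul_assoc, ← add_mul, ← eq_fstC_add_sndC_mul_unitJ]
  let G' : (m → Quaternion ℝ) →ₗ[Quaternion ℝ] (m → Quaternion ℝ) :=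
    { toFun := G
      map_add' := map_add G
      map_smul' := fun q x => by
        rw [hq, map_add, map_smul, map_smul, hG, RingHom.id_apply, hq] }
  refine ⟨LinearMap.toMatrixRight' G', fun x => ?_⟩
  exact LinearMap.congr_fun (LinearEquiv.symm_apply_apply LinearMap.toMatrixRight' G') x

theorem even_kerDim_of_strongly_real {X g : Matrix m m (Quaternion ℝ)} (hg : g * g = 1)
    (hgX : g * X = -X * g) {μ : ℂ} (hμ : μ.re = 0) (d : ℕ) :
    Even (kerDim ((Phi X - μ • 1) ^ d)) := by
  have hc : conj μ = -μ := by apply Complex.ext <;> simp [hμ]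
  have hXg : ∀ x, rowAct g (rowAct X x) = -rowAct X (rowAct g x) := fun x => by
    rw [rowAct_rowAct, rowAct_rowAct, hgX, neg_mul, rowAct_apply, rowAct_apply, Matrix.vecMul_neg,
      neg_neg]
  rw [← finrank_ker_rowAct_pow]
  refine even_finrank_of_antilinear ((leftJ m).comp (rowAct g)) _ (fun v hv => ?_) fun v _ => ?_
  · refine map_mem_ker_pow (rowAct X) (lam := μ) (c := -1) ((leftJ m).comp (rowAct g))
      (fun v => ?_) (map_zero _) _ hv
    simp only [LinearMap.comp_apply]
    rw [← leftJ_rowAct, neg_one_smul, map_neg, map_sub, hXg, map_smul, map_neg, map_sub, map_neg,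
      map_smulₛₗ, hc]
    module
  · rw [LinearMap.comp_apply, LinearMap.comp_apply, ← leftJ_rowAct, leftJ_leftJ, rowAct_rowAct, hg,
      rowAct_apply, Matrix.vecMul_one]

/-- On the generalized kernel a quaternionic linear involution anticommuting with `X` always
exists. -/
theorem exists_involution_on_maxGenEigenspace_zero (X : Matrix m m (Quaternion ℝ)) :
    ∃ g₀ : Module.End ℂ (m → Quaternion ℝ), ∀ v ∈ (rowAct X).maxGenEigenspace 0,
      g₀ v ∈ (rowAct X).maxGenEigenspace 0 ∧ g₀ (g₀ v) = v ∧
      g₀ (rowAct X v) = -rowAct X (g₀ v) ∧ g₀ (leftJ m v) = leftJ m (g₀ v) := by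
  have : CharZero (Quaternion ℝ) :=
    charZero_of_injective_algebraMap (algebraMap ℝ (Quaternion ℝ)).injective
  set L := Module.finrank ℂ (m → Quaternion ℝ)
  let N : Module.End (Quaternion ℝ) (m → Quaternion ℝ) := Matrix.toLinearMapRight' X
  obtain ⟨σ, hσ⟩ := exists_anticommuting_on_ker_pow (θ := RingHom.id (Quaternion ℝ))
    (fun _ => rfl) (ε := 1) rfl N L
    (fun _ C _ _ => ⟨LinearMap.id, fun v hv => ⟨hv, (one_smul ℤ v).symm⟩⟩)
  have hmem : ∀ v, v ∈ (rowAct X).maxGenEigenspace 0 ↔ v ∈ LinearMap.ker (N ^ L) := fun v => by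
    rw [maxGenEigenspace_eq_ker_pow, zero_smul, sub_zero, LinearMap.mem_ker, LinearMap.mem_ker,
      Module.End.pow_apply, Module.End.pow_apply]
    rfl
  refine ⟨{ toFun := σ, map_add' := map_add σ, map_smul' := fun z v => ?_ }, fun v hv => ?_⟩
  · exact σ.map_smul (z : Quaternion ℝ) v
  · obtain ⟨h1, h2, h3⟩ := hσ v ((hmem v).1 hv)
    exact ⟨(hmem _).2 h1, h2.trans (one_smul ℤ v), h3, σ.map_smul unitJ v⟩

theorem exists_strongly_real_of_even {X g : Matrix m m (Quaternion ℝ)} (hdet : (Phi g).det = 1)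
    (hgX : g * X = -X * g)
    (heven : ∀ μ : ℂ, μ.re = 0 → μ ≠ 0 → ∀ d : ℕ, 1 ≤ d → Even (tB (Phi X) μ d)) :
    ∃ g : Matrix m m (Quaternion ℝ), g * g = 1 ∧ g * X = -X * g := by
  have hanti : ∀ A : Matrix m m (Quaternion ℝ), A * X = -X * A ↔
      ∀ x, rowAct A (rowAct X x) = -rowAct X (rowAct A x) := fun A => by
    have h1 : ∀ x, rowAct (-X * A) x = - rowAct A (rowAct X x) := fun x => by
      rw [rowAct_rowAct, neg_mul, rowAct_apply, rowAct_apply, Matrix.vecMul_neg]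
    refine ⟨fun h x => ?_, fun h => rowAct_injective fun x => ?_⟩
    · rw [rowAct_rowAct _ X, h, h1, neg_neg]
    · rw [h1, h, neg_neg, rowAct_rowAct]
  have hu : IsUnit (LinearMap.det (rowAct g)) := by rw [det_rowAct, hdet]; exact isUnit_one
  let e := LinearMap.equivOfIsUnitDet hu
  have he : ∀ x, e x = rowAct g x := LinearMap.equivOfIsUnitDet_apply hu
  obtain ⟨g₀, hg₀⟩ := exists_involution_on_maxGenEigenspace_zero X
  obtain ⟨G, hG1, hG2, hG3⟩ := exists_involution_of_even (rowAct X) (rowAct g) e.symm.toLinearMap g₀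
    (leftJ m) leftJ_leftJ (leftJ_rowAct X) (fun v => (he _).symm.trans (e.apply_symm_apply v))
    (fun v => (congrArg e.symm (he v)).symm.trans (e.symm_apply_apply v))
    ((hanti g).1 hgX) (fun v => (leftJ_rowAct g v).symm) hg₀
    (fun μ h1 h2 d => by
      rw [finrank_ker_rowAct_pow, finrank_ker_rowAct_pow, finrank_ker_rowAct_pow]
      exact heven μ h1 h2 (d + 1) (Nat.le_add_left 1 d))
  obtain ⟨A, hA⟩ := exists_rowAct_eq G hG3
  refine ⟨A, rowAct_injective fun x => ?_, (hanti A).2 fun x => ?_⟩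
  · rw [← rowAct_rowAct, hA, hA, hG1, rowAct_apply, Matrix.vecMul_one]
  · rw [hA, hA, hG2]

end Reality

end QuaternionicReality

/-- classification of strongly Ad_{SL(n,ℍ)}-real elements of sl(n,ℍ). -/
theorem strongly_adSL_real_iff_quaternion (n : ℕ) (hn : 1 ≤ n)
    (X : Matrix (Fin n) (Fin n) (Quaternion ℝ)) (hX : X ≠ 0) (htr : (Phi X).trace = 0)
    (hreal : ∃ g : Matrix (Fin n) (Fin n) (Quaternion ℝ), (Phi g).det = 1 ∧ g * X = -X * g) :
    (∃ g : Matrix (Fin n) (Fin n) (Quaternion ℝ),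
        g * g = 1 ∧ (Phi g).det = 1 ∧ g * X = -X * g) ↔
      (∀ μ : ℂ, μ.re = 0 → μ ≠ 0 → ∀ d : ℕ, 1 ≤ d → Even (tB (Phi X) μ d)) := by
  constructor
  · rintro ⟨g, hg, -, hgX⟩ μ hμ - d -
    have h := fun k => (Int.even_coe_nat _).2
      (QuaternionicReality.even_kerDim_of_strongly_real hg hgX hμ k)
    exact ((even_two_mul _).sub (h _)).sub (h _)
  · intro heven
    obtain ⟨g₁, hdet, hg₁⟩ := hreal
    obtain ⟨g, hg, hgX⟩ := QuaternionicReality.exists_strongly_real_of_even hdet hg₁ heven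
    exact ⟨g, hg, QuaternionicReality.det_Phi_of_mul_self_eq_one hg, hgX⟩
end

section
/- Let n ≥ 1 and let X ∈ M(n,ℂ) be a diagonalizable matrix with trace 0 (i.e. there exist an invertible P ∈ M(n,ℂ) and D : Fin n → ℂ with X = P · diagonal D · P⁻¹) which is Ad_{SL(n,ℂ)}-real. Then X is strongly Ad_{SL(n,ℂ)}-real if and only if either 0 is an eigenvalue of X (equivalently det X = 0) or n is not congruent to 2 modulo 4. -/
open Matrix in
/-- A square root of `1` with vanishing trace has determinant `(-1) ^ (n / 2)`. -/
theorem Matrix.det_eq_neg_one_pow_of_mul_self_eq_one {n : ℕ} {g : Matrix (Fin n) (Fin n) ℂ}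
    (hg : g * g = 1) (htr : g.trace = 0) : g.det = (-1) ^ (n / 2) := by
  have hroots : ∀ r ∈ g.charpoly.roots, r = 1 ∨ r = -1 := by
    intro r hr
    have hr' : g.charpoly.IsRoot r := (Polynomial.mem_roots'.1 hr).2
    rw [Polynomial.IsRoot, Matrix.eval_charpoly, ← Matrix.exists_mulVec_eq_zero_iff] at hr'
    obtain ⟨v, hv0, hv⟩ := hr'
    have hgv : g *ᵥ v = r • v := by
      rw [Matrix.sub_mulVec, sub_eq_zero] at hv
      simpa [← Matrix.smul_eq_diagonal_mul, Matrix.scalar_apply] using hv.symm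
    have h2 : v = (r * r) • v := by
      calc v = (g * g) *ᵥ v := by rw [hg, Matrix.one_mulVec]
        _ = (r * r) • v := by
          rw [← Matrix.mulVec_mulVec, hgv, Matrix.mulVec_smul, hgv, smul_smul]
    obtain ⟨i, hi⟩ := Function.ne_iff.1 hv0
    have h3 : v i = r * r * v i := by simpa using congrFun h2 i
    exact mul_self_eq_one_iff.1 (mul_right_cancel₀ hi (by rw [one_mul]; exact h3.symm))
  have hcount : ∀ s : Multiset ℂ, (∀ r ∈ s, r = 1 ∨ r = -1) →
      ∃ k : ℕ, s.sum = s.card - 2 * k ∧ s.prod = (-1) ^ k := by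
    intro s
    induction s using Multiset.induction_on with
    | empty => exact fun _ => ⟨0, by simp⟩
    | cons a s ih =>
      intro h
      obtain ⟨k, hk, hp⟩ := ih fun r hr => h r (Multiset.mem_cons_of_mem hr)
      rcases h a (Multiset.mem_cons_self a s) with rfl | rfl
      · refine ⟨k, ?_, by simp [hp]⟩
        rw [Multiset.sum_cons, hk, Multiset.card_cons]; push_cast; ring
      · refine ⟨k + 1, ?_, by rw [Multiset.prod_cons, hp, pow_succ']⟩
        rw [Multiset.sum_cons, hk, Multiset.card_cons]; push_cast; ring
  obtain ⟨k, hk, hp⟩ := hcount _ hroots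
  have hcard : g.charpoly.roots.card = n := by
    rw [← (IsAlgClosed.splits g.charpoly).natDegree_eq_card_roots,
      Matrix.charpoly_natDegree_eq_dim, Fintype.card_fin]
  rw [← Matrix.trace_eq_sum_roots_charpoly, htr, hcard] at hk
  have hn : n = 2 * k := by
    have : (n : ℂ) = ((2 * k : ℕ) : ℂ) := by push_cast; linear_combination -hk
    exact_mod_cast this
  rw [Matrix.det_eq_prod_roots_charpoly, hp, hn]
  simp

/-- A matrix that anticommutes with an invertible matrix has trace zero. -/
theorem Matrix.trace_eq_zero_of_mul_eq_neg_mul {n : ℕ} {g X : Matrix (Fin n) (Fin n) ℂ}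
    (hX : X.det ≠ 0) (h : g * X = -X * g) : g.trace = 0 := by
  have hu : IsUnit X.det := isUnit_iff_ne_zero.2 hX
  have h1 : g.trace = -g.trace := by
    calc g.trace = (X⁻¹ * (X * g)).trace := by rw [Matrix.nonsing_inv_mul_cancel_left _ _ hu]
      _ = (X * g * X⁻¹).trace := Matrix.trace_mul_comm _ _
      _ = -(g * X * X⁻¹).trace := by rw [h]; simp
      _ = -g.trace := by rw [Matrix.mul_nonsing_inv_cancel_right _ _ hu]
  exact self_eq_neg.1 h1

/-- A matrix anticommuting with `diagonal D` intertwines `diagonal (f ∘ D)` and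
`diagonal (f ∘ (-D))`. -/
theorem Matrix.mul_diagonal_comp_of_mul_eq_neg_mul {n : ℕ} {G : Matrix (Fin n) (Fin n) ℂ}
    {D : Fin n → ℂ} (h : G * diagonal D = -diagonal D * G) (f : ℂ → ℂ) :
    G * diagonal (fun i => f (D i)) = diagonal (fun i => f (-D i)) * G := by
  ext i j
  have hij := congrFun (congrFun h i) j
  rw [Matrix.neg_mul, Matrix.neg_apply, Matrix.mul_diagonal, Matrix.diagonal_mul] at hij
  rw [Matrix.mul_diagonal, Matrix.diagonal_mul]
  have : G i j * (D j + D i) = 0 := by linear_combination hij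
  rcases mul_eq_zero.1 this with h0 | h0
  · simp [h0]
  · rw [eq_neg_of_add_eq_zero_left h0, mul_comm]

/-- Given an invertible `G` swapping two orthogonal idempotents `A` and `B`, gluing `G` on `A`,
its inverse on `B` and a square root of `1 - A - B` yields an involution. -/
theorem mul_self_eq_one_of_swap {R : Type*} [Ring R] {G G' A B C : R}
    (hGG' : G * G' = 1) (hG'G : G' * G = 1) (hGA : G * A = B * G) (hGB : G * B = A * G)
    (hA : A * A = A) (hB : B * B = B) (hAB : A * B = 0) (hBA : B * A = 0)
    (hAC : A * C = 0) (hCA : C * A = 0) (hBC : B * C = 0) (hCB : C * B = 0)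
    (hsum : A + B + C * C = 1) :
    (G * A + G' * B + C) * (G * A + G' * B + C) = 1 := by
  have hG'A : G' * A = B * G' := by
    calc G' * A = G' * (A * G) * G' := by rw [mul_assoc, mul_assoc, hGG', mul_one]
      _ = B * G' := by rw [← hGB, ← mul_assoc, hG'G, one_mul]
  have hG'B : G' * B = A * G' := by
    calc G' * B = G' * (B * G) * G' := by rw [mul_assoc, mul_assoc, hGG', mul_one]
      _ = A * G' := by rw [← hGA, ← mul_assoc, hG'G, one_mul]
  have e1 : G * A * (G * A) = 0 := by
    rw [mul_assoc, hGA, ← mul_assoc A, hAB, zero_mul, mul_zero]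
  have e2 : G * A * (G' * B) = B := by
    rw [mul_assoc, hG'B, ← mul_assoc A, hA, ← mul_assoc, hGA, mul_assoc, hGG', mul_one]
  have e3 : G' * B * (G * A) = A := by
    rw [mul_assoc, hGA, ← mul_assoc B, hB, ← mul_assoc, hG'B, mul_assoc, hG'G, mul_one]
  have e4 : G' * B * (G' * B) = 0 := by
    rw [mul_assoc, hG'B, ← mul_assoc B, hBA, zero_mul, mul_zero]
  have e5 : C * (G * A) = 0 := by rw [hGA, ← mul_assoc, hCB, zero_mul]
  have e6 : C * (G' * B) = 0 := by rw [hG'B, ← mul_assoc, hCA, zero_mul]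
  have e7 : G * A * C = 0 := by rw [mul_assoc, hAC, mul_zero]
  have e8 : G' * B * C = 0 := by rw [mul_assoc, hBC, mul_zero]
  simp only [mul_add, add_mul, e1, e2, e3, e4, e5, e6, e7, e8]
  rw [← hsum]
  abel

/-- The indicator function of a half plane containing exactly one of `z` and `-z` for
each nonzero `z`. -/
noncomputable def halfPlaneIndicator (z : ℂ) : ℂ :=
  open Classical in if 0 < z.re ∨ z.re = 0 ∧ 0 < z.im then 1 else 0

theorem halfPlaneIndicator_zero : halfPlaneIndicator 0 = 0 := by
  simp [halfPlaneIndicator]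

theorem halfPlaneIndicator_mul_self (z : ℂ) :
    halfPlaneIndicator z * halfPlaneIndicator z = halfPlaneIndicator z := by
  unfold halfPlaneIndicator
  split_ifs <;> simp

theorem halfPlaneIndicator_mul_neg (z : ℂ) :
    halfPlaneIndicator z * halfPlaneIndicator (-z) = 0 := by
  unfold halfPlaneIndicator
  simp only [Complex.neg_re, Complex.neg_im]
  split_ifs with h1 h2 <;> simp
  grind

theorem halfPlaneIndicator_add_neg {z : ℂ} (hz : z ≠ 0) :
    halfPlaneIndicator z + halfPlaneIndicator (-z) = 1 := by
  have hz' : ¬ (z.re = 0 ∧ z.im = 0) := fun h => hz (Complex.ext h.1 h.2)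
  unfold halfPlaneIndicator
  simp only [Complex.neg_re, Complex.neg_im]
  split_ifs with h1 h2 h2 <;> simp <;> grind

open Matrix in
/-- If `diagonal D` anticommutes with some invertible matrix, it anticommutes with an involution,
which can be prescribed up to sign on each coordinate vector of the kernel of `diagonal D`. -/
theorem Matrix.exists_involution_mul_diagonal {n : ℕ} {G : Matrix (Fin n) (Fin n) ℂ}
    {D : Fin n → ℂ} (hG : IsUnit G.det) (h : G * diagonal D = -diagonal D * G) :
    ∃ k : Matrix (Fin n) (Fin n) ℂ, ∀ d : Fin n → ℂ, (∀ i, d i * d i = 1) →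
      (∀ i, D i ≠ 0 → d i = 1) →
      k * diagonal d * (k * diagonal d) = 1 ∧
        k * diagonal d * diagonal D = -diagonal D * (k * diagonal d) := by
  set A : Matrix (Fin n) (Fin n) ℂ := diagonal fun i => halfPlaneIndicator (D i) with hAdef
  set B : Matrix (Fin n) (Fin n) ℂ := diagonal fun i => halfPlaneIndicator (-D i) with hBdef
  have h' : G⁻¹ * diagonal D = -diagonal D * G⁻¹ := by
    have h1 : diagonal D * G = -(G * diagonal D) := by
      rw [h, Matrix.neg_mul, neg_neg]
    calc G⁻¹ * diagonal D = G⁻¹ * (diagonal D * G) * G⁻¹ := by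
          rw [mul_assoc, Matrix.mul_nonsing_inv_cancel_right _ _ hG]
      _ = -diagonal D * G⁻¹ := by
          rw [h1, Matrix.mul_neg, Matrix.nonsing_inv_mul_cancel_left _ _ hG]
  refine ⟨G * A + G⁻¹ * B + diagonal fun i => if D i = 0 then 1 else 0, fun d hd hd' => ?_⟩
  set C : Matrix (Fin n) (Fin n) ℂ := diagonal fun i => if D i = 0 then d i else 0 with hCdef
  have hk : (G * A + G⁻¹ * B + diagonal fun i => if D i = 0 then (1 : ℂ) else 0) * diagonal d
      = G * A + G⁻¹ * B + C := by
    have hAd : A * diagonal d = A := by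
      simp only [hAdef, diagonal_mul_diagonal]
      congr 1; ext i
      by_cases hi : D i = 0
      · simp [hi, halfPlaneIndicator_zero]
      · simp [hd' i hi]
    have hBd : B * diagonal d = B := by
      simp only [hBdef, diagonal_mul_diagonal]
      congr 1; ext i
      by_cases hi : D i = 0
      · simp [hi, halfPlaneIndicator_zero]
      · simp [hd' i hi]
    rw [add_mul, add_mul, mul_assoc, mul_assoc, hAd, hBd, diagonal_mul_diagonal, hCdef]
    simp only [ite_mul, one_mul, zero_mul]
  rw [hk]
  have hCz : ∀ i, halfPlaneIndicator (D i) * (if D i = 0 then d i else 0) = 0 := by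
    intro i; split_ifs with hi <;> simp [hi, halfPlaneIndicator_zero]
  have hCz' : ∀ i, halfPlaneIndicator (-D i) * (if D i = 0 then d i else 0) = 0 := by
    intro i; split_ifs with hi <;> simp [hi, halfPlaneIndicator_zero]
  constructor
  · apply mul_self_eq_one_of_swap (Matrix.mul_nonsing_inv _ hG) (Matrix.nonsing_inv_mul _ hG)
    · exact mul_diagonal_comp_of_mul_eq_neg_mul h _
    · simpa using mul_diagonal_comp_of_mul_eq_neg_mul h fun z => halfPlaneIndicator (-z)
    · simp only [hAdef, diagonal_mul_diagonal, halfPlaneIndicator_mul_self]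
    · simp only [hBdef, diagonal_mul_diagonal, halfPlaneIndicator_mul_self]
    · simp only [hAdef, hBdef, diagonal_mul_diagonal, halfPlaneIndicator_mul_neg, diagonal_zero]
    · simp only [hAdef, hBdef, diagonal_mul_diagonal, mul_comm (halfPlaneIndicator (-_)),
        halfPlaneIndicator_mul_neg, diagonal_zero]
    · simp only [hAdef, hCdef, diagonal_mul_diagonal, hCz, diagonal_zero]
    · simp only [hAdef, hCdef, diagonal_mul_diagonal, mul_comm (ite _ _ _), hCz, diagonal_zero]
    · simp only [hBdef, hCdef, diagonal_mul_diagonal, hCz', diagonal_zero]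
    · simp only [hBdef, hCdef, diagonal_mul_diagonal, mul_comm (ite _ _ _), hCz', diagonal_zero]
    · rw [hAdef, hBdef, hCdef, diagonal_mul_diagonal, diagonal_add, diagonal_add, ← diagonal_one]
      congr 1; ext i
      by_cases hi : D i = 0
      · simp [hi, halfPlaneIndicator_zero, hd i]
      · simp [hi, halfPlaneIndicator_add_neg hi]
  · have hCD : C * diagonal D = 0 := by
      simp only [hCdef, diagonal_mul_diagonal, ite_mul, zero_mul]
      rw [← diagonal_zero]
      congr 1; ext i
      split_ifs with hi <;> simp [hi]
    have hDC : diagonal D * C = 0 := by rw [(commute_diagonal D _).eq, hCD]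
    have hAD : A * diagonal D = diagonal D * A := (commute_diagonal _ _).eq
    have hBD : B * diagonal D = diagonal D * B := (commute_diagonal _ _).eq
    rw [add_mul, add_mul, mul_add, mul_add, mul_assoc, mul_assoc, hAD, hBD, ← mul_assoc,
      ← mul_assoc, h, h', hCD, mul_assoc, mul_assoc, Matrix.neg_mul _ C, hDC, neg_zero]

open Matrix in
/-- For `X` diagonalizable and anticommuting with an invertible matrix, `X` anticommutes with
an involution, which can be taken of determinant `1` if `X` is singular. -/
theorem Matrix.exists_involution_mul_eq_neg_mul {n : ℕ} {X : Matrix (Fin n) (Fin n) ℂ}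
    (hdiag : ∃ (P : Matrix (Fin n) (Fin n) ℂ) (D : Fin n → ℂ),
        IsUnit P ∧ X = P * diagonal D * P⁻¹)
    (hreal : ∃ g : Matrix (Fin n) (Fin n) ℂ, g.det = 1 ∧ g * X = -X * g) :
    ∃ g : Matrix (Fin n) (Fin n) ℂ, g * g = 1 ∧ g * X = -X * g ∧ (X.det = 0 → g.det = 1) := by
  obtain ⟨P, D, hP, rfl⟩ := hdiag
  obtain ⟨g, hg, hgX⟩ := hreal
  have hPd : IsUnit P.det := (Matrix.isUnit_iff_isUnit_det P).1 hP
  have hPP : P * P⁻¹ = 1 := Matrix.mul_nonsing_inv _ hPd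
  have hPP' : P⁻¹ * P = 1 := Matrix.nonsing_inv_mul _ hPd
  have hG : P⁻¹ * g * P * diagonal D = -diagonal D * (P⁻¹ * g * P) := by
    calc P⁻¹ * g * P * diagonal D = P⁻¹ * (g * (P * diagonal D * P⁻¹)) * P := by
          simp only [mul_assoc, hPP', mul_one]
      _ = -((P⁻¹ * P) * diagonal D * (P⁻¹ * g * P)) := by
          rw [hgX]; simp only [neg_mul, mul_neg, mul_assoc]
      _ = -diagonal D * (P⁻¹ * g * P) := by rw [hPP', one_mul, neg_mul]
  have hGdet : IsUnit (P⁻¹ * g * P).det := by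
    rw [det_mul, det_mul, hg, mul_one, ← det_mul, hPP', det_one]; exact isUnit_one
  obtain ⟨k, hk⟩ := exists_involution_mul_diagonal hGdet hG
  have hconj : ∀ m : Matrix (Fin n) (Fin n) ℂ, m * m = 1 → m * diagonal D = -diagonal D * m →
      (P * m * P⁻¹) * (P * m * P⁻¹) = 1 ∧
      (P * m * P⁻¹) * (P * diagonal D * P⁻¹) = -(P * diagonal D * P⁻¹) * (P * m * P⁻¹) ∧
      (P * m * P⁻¹).det = m.det := by
    intro m hm hmD
    have key : ∀ a b : Matrix (Fin n) (Fin n) ℂ,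
        (P * a * P⁻¹) * (P * b * P⁻¹) = P * (a * b) * P⁻¹ := by
      intro a b
      calc (P * a * P⁻¹) * (P * b * P⁻¹) = P * a * (P⁻¹ * P) * b * P⁻¹ := by
            simp only [mul_assoc]
        _ = P * (a * b) * P⁻¹ := by rw [hPP', mul_one, mul_assoc P]
    refine ⟨by rw [key, hm, mul_one, hPP], ?_, ?_⟩
    · rw [neg_mul, key, key, hmD]; simp only [neg_mul, mul_neg]
    · rw [det_mul, det_mul, mul_right_comm, ← det_mul, hPP, det_one, one_mul]
  obtain ⟨h1, h2⟩ := hk (fun _ => 1) (by simp) (by simp)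
  rw [diagonal_one, mul_one] at h1 h2
  have hkdet : k.det = 1 ∨ k.det = -1 := by
    rw [← mul_self_eq_one_iff, ← det_mul, h1, det_one]
  obtain ⟨c1, c2, c3⟩ := hconj k h1 h2
  by_cases hkd : k.det = 1
  · exact ⟨_, c1, c2, fun _ => c3.trans hkd⟩
  by_cases hX : (P * diagonal D * P⁻¹).det = 0
  · have hD : ∃ i, D i = 0 := by
      rw [det_mul, det_mul, mul_right_comm, ← det_mul, hPP, det_one, one_mul, det_diagonal,
        Finset.prod_eq_zero_iff] at hX
      simpa using hX
    obtain ⟨i, hi⟩ := hD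
    obtain ⟨h3, h4⟩ := hk (fun j => if j = i then -1 else 1)
      (fun j => by split_ifs <;> simp) (fun j hj => if_neg (by rintro rfl; exact hj hi))
    obtain ⟨d1, d2, d3⟩ := hconj _ h3 h4
    refine ⟨_, d1, d2, fun _ => ?_⟩
    rw [d3, det_mul, hkdet.resolve_left hkd, det_diagonal]
    simp
  · exact ⟨_, c1, c2, fun h => absurd h hX⟩


/-- a semisimple (diagonalizable) Ad_{SL(n,ℂ)}-real element of sl(n,ℂ)
is strongly Ad_{SL(n,ℂ)}-real iff 0 is an eigenvalue or n ≢ 2 (mod 4). -/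
theorem semisimple_strongly_adSL_real_iff (n : ℕ) (hn : 1 ≤ n)
    (X : Matrix (Fin n) (Fin n) ℂ) (htr : X.trace = 0)
    (hdiag : ∃ (P : Matrix (Fin n) (Fin n) ℂ) (D : Fin n → ℂ),
        IsUnit P ∧ X = P * Matrix.diagonal D * P⁻¹)
    (hreal : ∃ g : Matrix (Fin n) (Fin n) ℂ, g.det = 1 ∧ g * X = -X * g) :
    (∃ g : Matrix (Fin n) (Fin n) ℂ, g.det = 1 ∧ g * g = 1 ∧ g * X = -X * g) ↔
      (X.det = 0 ∨ ¬ (n % 4 = 2)) := by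
  constructor
  · rintro ⟨g, hg, hgg, hgX⟩
    by_contra! hcon
    obtain ⟨hX, hmod⟩ := hcon
    have hdet := Matrix.det_eq_neg_one_pow_of_mul_self_eq_one hgg
      (Matrix.trace_eq_zero_of_mul_eq_neg_mul hX hgX)
    have hodd : Odd (n / 2) := Nat.odd_iff.2 (by omega)
    rw [hg, hodd.neg_one_pow] at hdet
    norm_num at hdet
  · intro hcase
    obtain ⟨g, hgg, hgX, hgdet⟩ := Matrix.exists_involution_mul_eq_neg_mul hdiag hreal
    by_cases hX : X.det = 0
    · exact ⟨g, hgdet hX, hgg, hgX⟩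
    have hmod := hcase.resolve_left hX
    have heven : Even n := by
      obtain ⟨u, hu, huX⟩ := hreal
      have hdet := congrArg Matrix.det huX
      rw [Matrix.det_mul, Matrix.det_mul, hu, one_mul, mul_one, Matrix.det_neg,
        Fintype.card_fin] at hdet
      by_contra hodd
      rw [(Nat.not_even_iff_odd.1 hodd).neg_one_pow, neg_one_mul] at hdet
      exact hX (self_eq_neg.1 hdet)
    have hhalf : Even (n / 2) := Nat.even_iff.2 (by have := Nat.even_iff.1 heven; omega)
    refine ⟨g, ?_, hgg, hgX⟩
    rw [Matrix.det_eq_neg_one_pow_of_mul_self_eq_one hgg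
      (Matrix.trace_eq_zero_of_mul_eq_neg_mul hX hgX), hhalf.neg_one_pow]
end

section
/- Let n ≥ 1 and let X ∈ M(n,ℍ) be a nilpotent quaternionic matrix. Then there exists g ∈ M(n,ℍ) with g · g = 1, det(Φ(g)) = 1, and g · X = −X · g. That is, every nilpotent element of sl(n,ℍ) is strongly Ad_{SL(n,ℍ)}-real. -/
/-- A nilpotent endomorphism of a vector space over a division ring in which `2` is invertible
anticommutes with some linear involution. -/
theorem exists_involution_anticommute_of_pow_eq_zero {D : Type*} [DivisionRing D] [NeZero (2 : D)]
    (k : ℕ) : ∀ {V : Type*} [AddCommGroup V] [Module D V] (f : V →ₗ[D] V), f ^ k = 0 →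
      ∃ g : V →ₗ[D] V, (∀ v, g (g v) = v) ∧ ∀ v, g (f v) = -f (g v) := by
  induction k with
  | zero =>
    intro V _ _ f hf
    have h0 : ∀ v : V, v = 0 := fun v => by simpa using LinearMap.congr_fun hf v
    exact ⟨LinearMap.id, fun v => rfl, fun v => (h0 _).trans (h0 _).symm⟩
  | succ k ih =>
    intro V _ _ f hf
    let W := LinearMap.range f
    let f' : W →ₗ[D] W := f.restrict fun v _ => LinearMap.mem_range_self f v
    have hpow : ∀ (m : ℕ) (w : W), (((f' ^ m) w : W) : V) = (f ^ m) (w : V) := by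
      intro m
      induction m with
      | zero => intro w; rfl
      | succ m ihm => intro w; rw [pow_succ, pow_succ]; exact ihm (f' w)
    obtain ⟨γ, hγγ, hγf⟩ := ih f' (by
      ext ⟨w, v, rfl⟩
      rw [hpow, ← Module.End.mul_apply, ← pow_succ, hf]
      rfl)
    have hγf' : ∀ w : W, f (γ w : V) = -(γ (f.rangeRestrict w) : V) := by
      intro w
      have h : γ (f.rangeRestrict w) = -f' (γ w) := hγf w
      rw [h]
      simp [f']
    obtain ⟨s, hs⟩ := f.rangeRestrict.exists_rightInverse_of_surjective
      (LinearMap.range_rangeRestrict f)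
    have hfs : ∀ w : W, f (s w) = w := fun w =>
      congrArg Subtype.val (LinearMap.congr_fun hs w)
    -- split off from the kernel a part `C₁` disjoint from the range
    obtain ⟨C₁, hC₁K, hdisj, hsup⟩ : ∃ C₁ : Submodule D V, C₁ ≤ LinearMap.ker f ∧
        Disjoint W C₁ ∧ LinearMap.ker f ≤ W ⊔ C₁ := by
      obtain ⟨C, hC⟩ := (W ⊓ LinearMap.ker f).exists_isCompl
      refine ⟨C ⊓ LinearMap.ker f, inf_le_right, ?_, ?_⟩
      · rw [disjoint_iff_inf_le, ← inf_assoc, inf_right_comm]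
        exact hC.inf_eq_bot.le
      · intro v hv
        obtain ⟨w, hw, c, hc, rfl⟩ := Submodule.mem_sup.1
          (hC.sup_eq_top ▸ Submodule.mem_top : v ∈ W ⊓ LinearMap.ker f ⊔ C)
        refine Submodule.mem_sup.2 ⟨w, hw.1, c, ⟨hc, ?_⟩, rfl⟩
        simpa using (LinearMap.ker f).sub_mem hv hw.2
    obtain ⟨C, hC₁C, hC⟩ := hdisj.symm.exists_isCompl
    let π : V →ₗ[D] W := W.projectionOnto C hC.symm
    have hπW : ∀ w : W, π w = w := fun w => Submodule.projectionOnto_apply_left hC.symm w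
    have hπC : ∀ c ∈ C, π c = 0 := fun c hc =>
      (Submodule.projectionOnto_apply_eq_zero_iff hC.symm).2 hc
    let F := f.rangeRestrict
    let h : V →ₗ[D] V := LinearMap.id - s ∘ₗ F - s ∘ₗ γ ∘ₗ F
    let g : V →ₗ[D] V := W.subtype ∘ₗ γ ∘ₗ π + h ∘ₗ (LinearMap.id - W.subtype ∘ₗ π)
    have hgW : ∀ w : W, g w = γ w := by
      intro w
      simp [g, hπW]
    have hgC₁ : ∀ c ∈ C₁, g c = c := by
      intro c hc
      have hFc : F c = 0 := Subtype.ext (hC₁K hc)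
      simp [g, h, hπC c (hC₁C hc), hFc]
    have hfh : ∀ v, f (h v) = -(γ (F v) : V) := by
      intro v
      simp [h, hfs, F]
    have hgf : ∀ v, g (f v) = -f (g v) := by
      intro v
      have h1 : g (f v) = γ (F v) := hgW (F v)
      have h2 : f (g v) = f (γ (π v) : V) + f (h (v - π v)) := by simp [g]
      rw [h1, h2, hγf', hfh, map_sub, map_sub]
      simp [F]
    let N : V →ₗ[D] V := g ∘ₗ g - LinearMap.id
    have hN : ∀ v, N v = g (g v) - v := fun v => rfl
    have hNW : ∀ w : W, N w = 0 := by
      intro w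
      rw [hN, hgW, hgW, hγγ, sub_self]
    have hNC₁ : ∀ c ∈ C₁, N c = 0 := by
      intro c hc
      rw [hN, hgC₁ c hc, hgC₁ c hc, sub_self]
    have hNf : ∀ v, N (f v) = 0 := fun v => hNW (F v)
    have hfN : ∀ v, f (N v) = 0 := by
      intro v
      rw [← hNf v, hN, hN, hgf, map_neg, hgf, map_sub, neg_neg]
    have hNN : ∀ v, N (N v) = 0 := by
      intro v
      obtain ⟨w, hw, c, hc, hwc⟩ := Submodule.mem_sup.1 (hsup (LinearMap.mem_ker.2 (hfN v)))
      rw [← hwc, map_add, hNC₁ c hc, hNW ⟨w, hw⟩, add_zero]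
    have hgN : ∀ v, g (N v) = N (g v) := by
      intro v
      rw [hN, hN, map_sub]
    let half : V →ₗ[D] V :=
      { toFun := fun v => (2 : D)⁻¹ • v
        map_add' := smul_add _
        map_smul' := fun a v => by
          have : Commute (2 : D)⁻¹ a := (Commute.ofNat_left 2 a).inv_left₀
          simp only [RingHom.id_apply, smul_smul, this.eq] }
    have hhalf : ∀ v, half v + half v = v := by
      intro v
      change (2 : D)⁻¹ • v + (2 : D)⁻¹ • v = v
      rw [← add_smul, ← two_mul, mul_inv_cancel₀ two_ne_zero, one_smul]
    have half_comm : ∀ (φ : V →ₗ[D] V) (v : V), φ (half v) = half (φ v) :=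
      fun φ v => map_smul φ _ v
    have hgg : ∀ v, g (g v) = N v + v := by
      intro v
      rw [hN, sub_add_cancel]
    -- as `N ^ 2 = 0`, `1 - N / 2` is an inverse square root of `g ^ 2 = 1 + N`
    refine ⟨g - half ∘ₗ g ∘ₗ N, fun v => ?_, fun v => ?_⟩
    · have h1 : g (g v - half (g (N v))) = v + half (N v) := by
        rw [map_sub, half_comm, hgg, hgg, hNN, zero_add]
        conv_lhs => enter [1, 1]; rw [← hhalf (N v)]
        abel
      have h2 : N (g v - half (g (N v))) = g (N v) := by
        rw [map_sub, half_comm, ← hgN, ← hgN, hNN, map_zero, map_zero, sub_zero]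
      simp only [LinearMap.sub_apply, LinearMap.comp_apply]
      rw [h1, h2, hgg, hNN, zero_add, add_sub_cancel_right]
    · simp only [LinearMap.sub_apply, LinearMap.comp_apply]
      rw [hNf, map_zero, map_zero, sub_zero, hgf, map_sub, half_comm,
        ← neg_eq_iff_eq_neg.2 (hgf (N v)), hfN, map_zero, neg_zero, map_zero, sub_zero]

/-- The rectangular version of `Phi`. -/
noncomputable def PhiRect {m n : Type*} (A : Matrix m n (Quaternion ℝ)) :
    Matrix (m ⊕ m) (n ⊕ n) ℂ :=
  Matrix.fromBlocks
    (Matrix.of fun k l => (⟨(A k l).re, (A k l).imI⟩ : ℂ))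
    (Matrix.of fun k l => (⟨(A k l).imJ, (A k l).imK⟩ : ℂ))
    (-(Matrix.of fun k l => (starRingEnd ℂ) (⟨(A k l).imJ, (A k l).imK⟩ : ℂ)))
    (Matrix.of fun k l => (starRingEnd ℂ) (⟨(A k l).re, (A k l).imI⟩ : ℂ))

theorem PhiRect_mul {l m n : Type*} [Fintype m] (A : Matrix l m (Quaternion ℝ))
    (B : Matrix m n (Quaternion ℝ)) : PhiRect (A * B) = PhiRect A * PhiRect B := by
  let α : Quaternion ℝ →+ ℂ :=
    { toFun := fun q => ⟨q.re, q.imI⟩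
      map_zero' := rfl
      map_add' := fun _ _ => rfl }
  let β : Quaternion ℝ →+ ℂ :=
    { toFun := fun q => ⟨q.imJ, q.imK⟩
      map_zero' := rfl
      map_add' := fun _ _ => rfl }
  have hα' : ∀ x, α x = ⟨x.re, x.imI⟩ := fun _ => rfl
  have hβ' : ∀ x, β x = ⟨x.imJ, x.imK⟩ := fun _ => rfl
  have hα : ∀ x y, α (x * y) = α x * α y - β x * starRingEnd ℂ (β y) := by
    intro x y
    apply Complex.ext <;> simp [hα', hβ'] <;> ring
  have hβ : ∀ x y, β (x * y) = α x * β y + β x * starRingEnd ℂ (α y) := by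
    intro x y
    apply Complex.ext <;> simp [hα', hβ'] <;> ring
  unfold PhiRect
  simp only [← hα', ← hβ']
  rw [Matrix.fromBlocks_multiply]
  congr 1 <;> refine Matrix.ext fun i j => ?_ <;>
    simp only [Matrix.of_apply, Matrix.add_apply, Matrix.neg_apply, Matrix.mul_apply, map_sum, hα,
      hβ, ← Finset.sum_add_distrib, ← Finset.sum_neg_distrib, map_sub, map_add, map_mul,
      Complex.conj_conj, mul_neg, ← sub_eq_add_neg]
  all_goals refine Finset.sum_congr rfl fun x _ => ?_
  all_goals ring

theorem PhiRect_sub {m n : Type*} (A B : Matrix m n (Quaternion ℝ)) :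
    PhiRect (A - B) = PhiRect A - PhiRect B := by
  unfold PhiRect
  ext (i | i) (j | j) <;> apply Complex.ext <;> simp [sub_eq_add_neg, add_comm]

theorem PhiRect_one {m : Type*} [DecidableEq m] :
    PhiRect (1 : Matrix m m (Quaternion ℝ)) = 1 := by
  unfold PhiRect
  ext (i | i) (j | j) <;> apply Complex.ext <;> by_cases h : i = j <;>
    simp [h, Matrix.one_apply] <;> rfl

/-- A quaternionic matrix `1 - 2 A B` with `B A = 1` is mapped by `Phi` to a matrix of
determinant `1`. -/
theorem det_Phi_one_sub_eq_one {m r : Type*} [Fintype m] [DecidableEq m] [Fintype r]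
    [DecidableEq r] (A : Matrix m r (Quaternion ℝ)) (B : Matrix r m (Quaternion ℝ))
    (h : B * A = 1) : (Phi (1 - (A + A) * B)).det = 1 := by
  change (PhiRect (1 - (A + A) * B)).det = 1
  have h2 : (1 : Matrix (r ⊕ r) (r ⊕ r) ℂ) - PhiRect (1 + 1 : Matrix r r (Quaternion ℝ)) = -1 := by
    rw [show (1 + 1 : Matrix r r (Quaternion ℝ)) = 1 - (1 - 1 - 1) by abel, PhiRect_sub,
      PhiRect_sub, PhiRect_sub, PhiRect_one]
    abel
  rw [PhiRect_sub, PhiRect_one, PhiRect_mul, Matrix.det_one_sub_mul_comm, ← PhiRect_mul,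
    Matrix.mul_add, h]
  rw [h2, Matrix.det_neg, Matrix.det_one, mul_one, Fintype.card_sum]
  exact Even.neg_one_pow ⟨_, rfl⟩

/-- An idempotent matrix over a division ring has a rank factorization. -/
theorem exists_mul_eq_of_isIdempotentElem {D m : Type*} [DivisionRing D] [Fintype m]
    [DecidableEq m] (P : Matrix m m D) (hP : P * P = P) :
    ∃ (r : ℕ) (A : Matrix m (Fin r) D) (B : Matrix (Fin r) m D), A * B = P ∧ B * A = 1 := by
  let p := P.toLinearMapRight'
  let e := (Module.finBasis D (LinearMap.range p)).equivFun
  have hp : ∀ v, p (p v) = p v := fun v => by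
    rw [← Matrix.toLinearMapRight'_mul_apply, hP]
  refine ⟨_, Matrix.toLinearMapRight'.symm (e.toLinearMap ∘ₗ p.rangeRestrict),
    Matrix.toLinearMapRight'.symm (p.range.subtype ∘ₗ e.symm.toLinearMap), ?_, ?_⟩
  · apply Matrix.toLinearMapRight'.injective
    rw [Matrix.toLinearMapRight'_mul, LinearEquiv.apply_symm_apply, LinearEquiv.apply_symm_apply]
    refine LinearMap.ext fun v => ?_
    simp [p]
  · apply Matrix.toLinearMapRight'.injective
    rw [Matrix.toLinearMapRight'_mul, LinearEquiv.apply_symm_apply, LinearEquiv.apply_symm_apply,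
      Matrix.toLinearMapRight'_one]
    refine LinearMap.ext fun v => ?_
    simp only [LinearMap.comp_apply, LinearEquiv.coe_coe, LinearMap.id_apply]
    rw [← e.eq_symm_apply]
    obtain ⟨u, hu⟩ := (e.symm v).2
    refine Subtype.ext ?_
    change p (e.symm v : m → D) = e.symm v
    rw [← hu, hp]

/-- Quaternionic involutions have determinant `1`. -/
theorem det_Phi_eq_one_of_mul_self_eq_one {m : Type*} [Fintype m] [DecidableEq m]
    (g : Matrix m m (Quaternion ℝ)) (hg : g * g = 1) : (Phi g).det = 1 := by
  let P : Matrix m m (Quaternion ℝ) := (2⁻¹ : ℝ) • (1 - g)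
  have hPP : P + P = 1 - g := by
    rw [← add_smul]
    norm_num
  have hP : P * P = P := by
    have h1 : (1 - g) * (1 - g) = (2 : ℝ) • (1 - g) := by
      rw [two_smul, sub_mul, mul_sub, mul_sub, hg]
      simp only [one_mul, mul_one]
      abel
    simp only [P]
    rw [smul_mul_smul_comm, h1, smul_smul]
    norm_num
  obtain ⟨r, A, B, hAB, hBA⟩ := exists_mul_eq_of_isIdempotentElem P hP
  have hgAB : g = 1 - (A + A) * B := by
    rw [Matrix.add_mul, hAB, hPP, sub_sub_cancel]
  rw [hgAB]
  exact det_Phi_one_sub_eq_one A B hBA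

/-- every nilpotent element of sl(n,ℍ) is strongly Ad_{SL(n,ℍ)}-real. -/
theorem nilpotent_strongly_adSL_real_quaternion (n : ℕ) (hn : 1 ≤ n)
    (X : Matrix (Fin n) (Fin n) (Quaternion ℝ)) (hnil : IsNilpotent X) :
    ∃ g : Matrix (Fin n) (Fin n) (Quaternion ℝ),
      g * g = 1 ∧ (Phi g).det = 1 ∧ g * X = -X * g := by
  obtain ⟨k, hk⟩ := hnil
  let τ := Matrix.toLinearMapRight' (R := Quaternion ℝ) (m := Fin n) (n := Fin n)
  have hpow : ∀ j : ℕ, τ (X ^ j) = τ X ^ j := by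
    intro j
    induction j with
    | zero => exact Matrix.toLinearMapRight'_one
    | succ j ihj =>
      rw [pow_succ, pow_succ', ← ihj]
      exact Matrix.toLinearMapRight'_mul _ _
  have : CharZero (Quaternion ℝ) :=
    charZero_of_injective_algebraMap (algebraMap ℝ (Quaternion ℝ)).injective
  obtain ⟨g, hgg, hgf⟩ := exists_involution_anticommute_of_pow_eq_zero k (τ X)
    (by rw [← hpow, hk, map_zero])
  have h1 : τ.symm g * τ.symm g = 1 := by
    apply τ.injective
    rw [Matrix.toLinearMapRight'_mul, LinearEquiv.apply_symm_apply, Matrix.toLinearMapRight'_one]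
    exact LinearMap.ext hgg
  refine ⟨τ.symm g, h1, det_Phi_eq_one_of_mul_self_eq_one _ h1, ?_⟩
  apply τ.injective
  rw [neg_mul, map_neg, Matrix.toLinearMapRight'_mul, Matrix.toLinearMapRight'_mul,
    LinearEquiv.apply_symm_apply]
  refine LinearMap.ext fun v => ?_
  simp only [LinearMap.comp_apply, LinearMap.neg_apply]
  rw [hgf, neg_neg]
end

section
/- Let n ≥ 1 and let X ∈ M(n,ℂ) be a nilpotent matrix. Then X is strongly Ad_{SL(n,ℂ)}-real if and only if it is NOT the case that all three of the following hold: (i) t_d(X,0) = 0 for every odd d ≥ 1; (ii) t_d(X,0) is odd for at least one d ≥ 1; (iii) the sum of t_d(X,0) over all d ≥ 1 with d ≡ 2 (mod 4) is odd. -/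
/-- The basis `b` is made of Jordan chains of lengths `k i` for the nilpotent endomorphism `f`. -/
def IsJordanBasis {K V : Type*} [Field K] [AddCommGroup V] [Module K V]
    {r : ℕ} {k : Fin r → ℕ} (f : Module.End K V) (b : Module.Basis (Σ i, Fin (k i)) K V) : Prop :=
  ∀ (i : Fin r) (j : Fin (k i)),
    f (b ⟨i, j⟩) = if h : (j : ℕ) + 1 < k i then b ⟨i, ⟨j + 1, h⟩⟩ else 0

open Polynomial in
theorem exists_basis_quotient_X_pow (K : Type*) [Field K] (k : ℕ) :
    ∃ c : Module.Basis (Fin k) K (K[X] ⧸ Submodule.span K[X] {(X : K[X]) ^ k}),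
      ∀ j : Fin k, (X : K[X]) • c j = if h : (j : ℕ) + 1 < k then c ⟨j + 1, h⟩ else 0 := by
  let c := (AdjoinRoot.powerBasis' (monic_X_pow (R := K) k)).basis.reindex
    (finCongr (natDegree_X_pow (R := K) k))
  have hc (j : Fin k) : c j = AdjoinRoot.mk (X ^ k) (X ^ (j : ℕ)) := by
    simp only [c, Module.Basis.reindex_apply, PowerBasis.basis_eq_pow,
      AdjoinRoot.powerBasis'_gen, map_pow, AdjoinRoot.mk_X]
    rfl
  refine ⟨c, fun j => ?_⟩
  have hX : (X : K[X]) • (show K[X] ⧸ Submodule.span K[X] {(X : K[X]) ^ k} from c j) =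
      AdjoinRoot.mk (X ^ k) (X ^ ((j : ℕ) + 1)) := by
    rw [hc, pow_succ']
    rfl
  refine hX.trans ?_
  split_ifs with h
  · exact (hc ⟨j + 1, h⟩).symm
  · rw [show (j : ℕ) + 1 = k by omega]
    exact AdjoinRoot.mk_self

open Polynomial in
/-- Jordan normal form of a nilpotent endomorphism. -/
theorem Module.End.exists_jordan_basis {K V : Type*} [Field K] [AddCommGroup V] [Module K V]
    [FiniteDimensional K V] {f : Module.End K V} (hf : IsNilpotent f) :
    ∃ (r : ℕ) (k : Fin r → ℕ) (b : Module.Basis (Σ i, Fin (k i)) K V),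
      IsJordanBasis f b := by
  have htors : Module.IsTorsion' (Module.AEval' f) (Submonoid.powers (X : K[X])) := by
    rw [Submodule.isTorsion'_powers_iff]
    obtain ⟨N, hN⟩ := hf
    intro x
    obtain ⟨v, rfl⟩ := (Module.AEval'.of f).surjective x
    exact ⟨N, by rw [Module.AEval'.X_pow_smul_of, hN]; simp⟩
  obtain ⟨r, k, ⟨e⟩⟩ := Module.torsion_by_prime_power_decomposition irreducible_X htors
  choose c hc using fun i : Fin r => exists_basis_quotient_X_pow K (k i)
  let e' := e.trans (DirectSum.linearEquivFunOnFintype K[X] (Fin r)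
    fun i => K[X] ⧸ Submodule.span K[X] {(X : K[X]) ^ k i})
  let b := ((Pi.basis c).map (e'.restrictScalars K).symm).map (Module.AEval'.of f).symm
  have hb (i) (j : Fin (k i)) : b ⟨i, j⟩ =
      (Module.AEval'.of f).symm (e'.symm (Pi.single i (c i j))) := by
    simp [b, Pi.basis_apply]
  refine ⟨r, k, b, fun i j => ?_⟩
  apply (Module.AEval'.of f).injective
  rw [← Module.AEval'.X_smul_of, hb, LinearEquiv.apply_symm_apply, ← map_smul,
    ← Pi.single_smul, hc]
  split_ifs with h
  · rw [hb, LinearEquiv.apply_symm_apply]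
  · simp

namespace IsJordanBasis

variable {K V : Type*} [Field K] [AddCommGroup V] [Module K V]
  {r : ℕ} {k : Fin r → ℕ} {f : Module.End K V}
  {b : Module.Basis (Σ i, Fin (k i)) K V}

theorem pow_apply (hb : IsJordanBasis f b) (d : ℕ) (i : Fin r) (j : Fin (k i)) :
    (f ^ d) (b ⟨i, j⟩) = if h : (j : ℕ) + d < k i then b ⟨i, ⟨j + d, h⟩⟩ else 0 := by
  induction d with
  | zero => simp
  | succ d ih =>
    rw [pow_succ', Module.End.mul_apply, ih]
    split_ifs with h₁ h₂ h₂
    · rw [hb, dif_pos (by exact h₂)]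
      rfl
    · rw [hb, dif_neg (by exact h₂)]
    · omega
    · simp

theorem range_pow (hb : IsJordanBasis f b) (d : ℕ) :
    LinearMap.range (f ^ d) =
      Submodule.span K (Set.range fun p : {p : Σ i, Fin (k i) // d ≤ p.2} => b p) := by
  rw [LinearMap.range_eq_map, ← b.span_eq, Submodule.map_span, ← Set.range_comp]
  apply le_antisymm <;> rw [Submodule.span_le] <;> rintro _ ⟨p, rfl⟩
  · obtain ⟨i, j⟩ := p
    rw [SetLike.mem_coe, Function.comp_apply, hb.pow_apply]
    split_ifs with h
    · exact Submodule.subset_span ⟨⟨⟨i, ⟨j + d, h⟩⟩, Nat.le_add_left _ _⟩, rfl⟩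
    · exact zero_mem _
  · obtain ⟨⟨i, j⟩, hj : d ≤ (j : ℕ)⟩ := p
    refine Submodule.subset_span ⟨⟨i, ⟨j - d, by omega⟩⟩, ?_⟩
    rw [Function.comp_apply, hb.pow_apply, dif_pos (by simp; omega)]
    simp [Nat.sub_add_cancel hj]

theorem finrank_range_pow (hb : IsJordanBasis f b) (d : ℕ) :
    Module.finrank K (LinearMap.range (f ^ d)) = ∑ i, (k i - d) := by
  rw [hb.range_pow, finrank_span_eq_card (b := fun p : {p : Σ i, Fin (k i) // d ≤ p.2} => b p)
      (b.linearIndependent.comp _ Subtype.val_injective),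
    Fintype.card_subtype, Finset.card_filter, Fintype.sum_sigma]
  refine Finset.sum_congr rfl fun i _ => ?_
  rw [Fin.sum_univ_eq_sum_range (fun j => if d ≤ j then 1 else 0), ← Finset.card_filter,
    ← Nat.card_Ico]
  congr 1
  ext j
  simp [and_comm]

theorem finrank_eq (b : Module.Basis (Σ i, Fin (k i)) K V) : Module.finrank K V = ∑ i, k i := by
  simp [Module.finrank_eq_card_basis b]

theorem finrank_ker_pow (hb : IsJordanBasis f b) (d : ℕ) :
    (Module.finrank K (LinearMap.ker (f ^ d)) : ℤ) = ∑ i, ((k i : ℤ) - (k i - d : ℕ)) := by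
  have : FiniteDimensional K V := .of_basis b
  have h := LinearMap.finrank_range_add_finrank_ker (f ^ d)
  rw [hb.finrank_range_pow, finrank_eq b] at h
  rw [Finset.sum_sub_distrib, ← Nat.cast_sum, ← Nat.cast_sum]
  lia

/-- If all Jordan blocks have even size, an endomorphism anticommuting with `f` is traceless:
the endomorphism `z` below satisfies `f * z + z * f = 1`. -/
theorem trace_eq_zero_of_anticommute (hb : IsJordanBasis f b) (hk : ∀ i, Even (k i))
    {g : Module.End K V} (hg : g * f = -(f * g)) : LinearMap.trace K V g = 0 := by
  let z : Module.End K V := b.constr K fun p =>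
    if Odd (p.2 : ℕ) then b ⟨p.1, ⟨p.2 - 1, by omega⟩⟩ else 0
  have hz (i) (j : Fin (k i)) :
      z (b ⟨i, j⟩) = if Odd (j : ℕ) then b ⟨i, ⟨j - 1, by omega⟩⟩ else 0 := by
    exact b.constr_basis K _ _
  have key : f * z + z * f = 1 := by
    refine b.ext fun ⟨i, j⟩ => ?_
    rw [LinearMap.add_apply, Module.End.mul_apply, Module.End.mul_apply, hz, hb,
      Module.End.one_apply]
    have hi := hk i
    by_cases hj : Odd (j : ℕ)
    · have hj' : 1 ≤ (j : ℕ) := hj.pos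
      rw [if_pos hj, hb, dif_pos (by simp; omega)]
      have : z (if h : (j : ℕ) + 1 < k i then b ⟨i, ⟨j + 1, h⟩⟩ else 0) = 0 := by
        split_ifs
        · rw [hz, if_neg (by simpa [parity_simps] using hj)]
        · simp
      rw [this, add_zero]
      simp [Nat.sub_add_cancel hj']
    · have hj' : (j : ℕ) + 1 < k i := by grind
      rw [if_neg hj, dif_pos hj', hz, if_pos (by simpa [parity_simps] using hj)]
      simp
  calc LinearMap.trace K V g
      = LinearMap.trace K V (g * f * z) + LinearMap.trace K V (g * (z * f)) := by
        rw [← map_add, mul_assoc, ← mul_add, key, mul_one]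
    _ = 0 := by
        rw [← mul_assoc, LinearMap.trace_mul_comm K (g * z), hg, ← mul_assoc, ← map_add]
        simp

/-- The diagonal endomorphism with entries `± s i`, alternating along the `i`-th chain. -/
noncomputable def alternating (b : Module.Basis (Σ i, Fin (k i)) K V) (s : Fin r → K) :
    Module.End K V :=
  b.constr K fun p => (s p.1 * (-1) ^ (p.2 : ℕ)) • b p

theorem alternating_apply (s : Fin r → K) (i : Fin r) (j : Fin (k i)) :
    alternating b s (b ⟨i, j⟩) = (s i * (-1) ^ (j : ℕ)) • b ⟨i, j⟩ := by
  exact b.constr_basis K _ _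

theorem alternating_mul_self {s : Fin r → K} (hs : ∀ i, s i * s i = 1) :
    alternating b s * alternating b s = 1 := by
  refine b.ext fun ⟨i, j⟩ => ?_
  rw [Module.End.mul_apply, alternating_apply, map_smul, alternating_apply, smul_smul,
    mul_mul_mul_comm, hs, ← mul_pow]
  simp

theorem alternating_anticommute (hb : IsJordanBasis f b) (s : Fin r → K) :
    alternating b s * f = -(f * alternating b s) := by
  refine b.ext fun ⟨i, j⟩ => ?_
  rw [LinearMap.neg_apply, Module.End.mul_apply, Module.End.mul_apply, alternating_apply,
    map_smul, hb]
  split_ifs with h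
  · rw [alternating_apply, pow_succ, ← neg_smul]
    simp
  · simp

theorem det_alternating (b : Module.Basis (Σ i, Fin (k i)) K V) (s : Fin r → K) :
    LinearMap.det (alternating b s) =
      (∏ i, s i ^ k i) * LinearMap.det (alternating b (1 : Fin r → K)) := by
  have h (s : Fin r → K) : LinearMap.det (alternating b s) =
      ∏ p : Σ i, Fin (k i), (s p.1 * (-1) ^ (p.2 : ℕ)) := by
    rw [← LinearMap.det_toMatrix b, ← Matrix.det_diagonal]
    congr 1
    ext p q
    obtain ⟨i, j⟩ := q
    rw [LinearMap.toMatrix_apply, alternating_apply, map_smul, Module.Basis.repr_self,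
      Finsupp.smul_apply, Matrix.diagonal_apply, Finsupp.single_apply]
    by_cases hp : p = ⟨i, j⟩
    · subst hp
      simp
    · simp [hp, Ne.symm hp]
  rw [h, h, Finset.prod_mul_distrib]
  simp [Fintype.prod_sigma]

/-- If a Jordan block has odd size, some involution of determinant `1` anticommutes with `f`. -/
theorem exists_of_odd (hb : IsJordanBasis f b) {i : Fin r} (hi : Odd (k i)) :
    ∃ g : Module.End K V, LinearMap.det g = 1 ∧ g * g = 1 ∧ g * f = -(f * g) := by
  set c := LinearMap.det (alternating b (1 : Fin r → K)) with hc
  have hcc : c * c = 1 := by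
    rw [hc, ← map_mul, alternating_mul_self (by simp), map_one]
  refine ⟨alternating b (Function.update 1 i c), ?_, alternating_mul_self fun j => ?_,
    hb.alternating_anticommute _⟩
  · rw [det_alternating, ← hc, Finset.prod_eq_single i]
    · obtain ⟨m, hm⟩ := hi
      rw [Function.update_self, hm, pow_succ, pow_mul, sq, hcc, one_pow, one_mul, hcc]
    · intro j _ hj
      simp [hj]
    · simp
  · by_cases hj : j = i
    · subst hj; simpa using hcc
    · simp [hj]

end IsJordanBasis

/-- A traceless complex involution has even size `2 * m` and determinant `(-1) ^ m`. -/
theorem Matrix.exists_det_eq_of_mul_self_of_trace {n : ℕ} {g : Matrix (Fin n) (Fin n) ℂ}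
    (hg : g * g = 1) (ht : g.trace = 0) : ∃ m, n = 2 * m ∧ g.det = (-1) ^ m := by
  have hroot : ∀ x ∈ g.charpoly.roots, x = 1 ∨ x = -1 := by
    intro x hx
    have hs : x ∈ spectrum ℂ g :=
      Matrix.mem_spectrum_of_isRoot_charpoly (Polynomial.isRoot_of_mem_roots hx)
    have hx2 := spectrum.pow_mem_pow g 2 hs
    rw [sq g, hg] at hx2
    have : Nontrivial (Matrix (Fin n) (Fin n) ℂ) := by
      by_contra h
      rw [not_nontrivial_iff_subsingleton] at h
      simp at hs
    rw [← sq_eq_one_iff]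
    simpa using hx2
  have hcard : g.charpoly.roots.card = n := by
    rw [← (IsAlgClosed.splits g.charpoly).natDegree_eq_card_roots, g.charpoly_natDegree_eq_dim,
      Fintype.card_fin]
  have hm : ∀ s : Multiset ℂ, (∀ x ∈ s, x = 1 ∨ x = -1) →
      ∃ p m : ℕ, s.card = p + m ∧ s.sum = p - m ∧ s.prod = (-1) ^ m := by
    intro s
    induction s using Multiset.induction_on with
    | empty => exact fun _ => ⟨0, 0, by simp⟩
    | cons x s ih =>
      intro h
      obtain ⟨p, m, h₁, h₂, h₃⟩ := ih fun y hy => h y (Multiset.mem_cons_of_mem hy)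
      rcases h x (Multiset.mem_cons_self x s) with rfl | rfl
      · exact ⟨p + 1, m, by simp [h₁]; ring, by simp [h₂]; ring, by simp [h₃]⟩
      · exact ⟨p, m + 1, by simp [h₁]; ring, by simp [h₂]; ring, by simp [h₃, pow_succ]⟩
  obtain ⟨p, m, h₁, h₂, h₃⟩ := hm _ hroot
  rw [← Matrix.trace_eq_sum_roots_charpoly, ht] at h₂
  have hpm : p = m := by exact_mod_cast (sub_eq_zero.mp h₂.symm)
  exact ⟨m, by omega, by rw [Matrix.det_eq_prod_roots_charpoly, h₃]⟩

/-- In terms of a Jordan basis, `tB X 0 d` counts the chains of length `d`. -/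
theorem tB_zero_eq_card {n r : ℕ} {k : Fin r → ℕ} {X : Matrix (Fin n) (Fin n) ℂ}
    {b : Module.Basis (Σ i, Fin (k i)) ℂ (Fin n → ℂ)} (hb : IsJordanBasis (Matrix.toLin' X) b)
    {d : ℕ} (hd : 1 ≤ d) : tB X 0 d = (Finset.univ.filter fun i => k i = d).card := by
  have hker (e : ℕ) : (kerDim ((X - (0 : ℂ) • 1) ^ e) : ℤ) =
      ∑ i, ((k i : ℤ) - (k i - e : ℕ)) := by
    rw [← hb.finrank_ker_pow, ← Matrix.toLin'_pow, zero_smul, sub_zero]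
    rfl
  rw [tB, hker, hker, hker, Finset.mul_sum, ← Finset.sum_sub_distrib, ← Finset.sum_sub_distrib,
    Finset.card_filter, Nat.cast_sum]
  refine Finset.sum_congr rfl fun i _ => ?_
  split_ifs <;> lia

/-- Parity of half the sum of even parts. -/
theorem even_card_filter_mod_four_iff {ι : Type*} [Fintype ι] {k : ι → ℕ} {m : ℕ}
    (hk : ∀ i, Even (k i)) (hm : ∑ i, k i = 2 * m) :
    Even (Finset.univ.filter fun i => k i % 4 = 2).card ↔ Even m := by
  have h : ∑ i, k i = 4 * ∑ i, k i / 4 + 2 * (Finset.univ.filter fun i => k i % 4 = 2).card := by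
    rw [Finset.card_filter, Finset.mul_sum, Finset.mul_sum, ← Finset.sum_add_distrib]
    refine Finset.sum_congr rfl fun i _ => ?_
    have := Nat.even_iff.mp (hk i)
    split_ifs <;> omega
  rw [Nat.even_iff, Nat.even_iff]
  omega

/-- a nilpotent complex matrix is strongly Ad_{SL(n,ℂ)}-real iff its
partition does not lie in the exceptional set P̃ₑ(n). -/
theorem nilpotent_strongly_adSL_real_iff (n : ℕ) (hn : 1 ≤ n)
    (X : Matrix (Fin n) (Fin n) ℂ) (hnil : IsNilpotent X) :
    (∃ g : Matrix (Fin n) (Fin n) ℂ, g.det = 1 ∧ g * g = 1 ∧ g * X = -X * g) ↔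
      ¬ ((∀ d : ℕ, 1 ≤ d → Odd d → tB X 0 d = 0) ∧
         (∃ d : ℕ, 1 ≤ d ∧ Odd (tB X 0 d)) ∧
         Odd (∑ d ∈ (Finset.range (n + 1)).filter (fun d => d % 4 = 2), tB X 0 d)) := by
  obtain ⟨r, k, b, hb⟩ := Module.End.exists_jordan_basis
    (f := Matrix.toLin' X) (hnil.map Matrix.toLinAlgEquiv')
  have hsum : ∑ i, k i = n := by
    rw [← IsJordanBasis.finrank_eq b, Module.finrank_fin_fun]
  have hodd : (∀ d : ℕ, 1 ≤ d → Odd d → tB X 0 d = 0) ↔ ∀ i, Even (k i) := by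
    constructor
    · intro h i
      by_contra hi
      rw [Nat.not_even_iff_odd] at hi
      have := h (k i) hi.pos hi
      rw [tB_zero_eq_card hb hi.pos, Nat.cast_eq_zero, Finset.card_eq_zero] at this
      exact Finset.notMem_empty i (this ▸ by simp)
    · intro h d hd hd'
      rw [tB_zero_eq_card hb hd, Nat.cast_eq_zero, Finset.card_eq_zero,
        Finset.filter_eq_empty_iff]
      rintro i - rfl
      exact Nat.not_even_iff_odd.mpr hd' (h i)
  have hcount : ∑ d ∈ (Finset.range (n + 1)).filter (fun d => d % 4 = 2), tB X 0 d =
      ((Finset.univ.filter fun i => k i % 4 = 2).card : ℤ) := by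
    rw [Finset.card_eq_sum_card_fiberwise (f := k)
      (t := (Finset.range (n + 1)).filter (fun d => d % 4 = 2)), Nat.cast_sum]
    · refine Finset.sum_congr rfl fun d hd => ?_
      rw [Finset.mem_filter] at hd
      rw [tB_zero_eq_card hb (by omega), Finset.filter_filter]
      congr 2
      ext i
      simp only [Finset.mem_filter, Finset.mem_univ, true_and]
      exact ⟨fun h => ⟨h ▸ hd.2, h⟩, And.right⟩
    · intro i hi
      have hle : k i ≤ n := hsum ▸
        Finset.single_le_sum (fun _ _ => Nat.zero_le _) (Finset.mem_univ i)
      simpa [Nat.lt_succ_iff, hle] using hi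
  have hexists : Odd (∑ d ∈ (Finset.range (n + 1)).filter (fun d => d % 4 = 2), tB X 0 d) →
      ∃ d : ℕ, 1 ≤ d ∧ Odd (tB X 0 d) := by
    intro h
    by_contra! hne
    refine Int.not_even_iff_odd.mpr h (Finset.even_sum _ fun d hd => ?_)
    rw [Finset.mem_filter] at hd
    exact Int.not_odd_iff_even.mp (hne d (by omega))
  have hdet (hk : ∀ i, Even (k i)) {g : Matrix (Fin n) (Fin n) ℂ} (hg : g * g = 1)
      (hgX : g * X = -X * g) :
      g.det = 1 ↔ Even (Finset.univ.filter fun i => k i % 4 = 2).card := by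
    have htr : g.trace = 0 := by
      rw [← Matrix.trace_toLin'_eq]
      refine hb.trace_eq_zero_of_anticommute hk ?_
      rw [Module.End.mul_eq_comp, Module.End.mul_eq_comp, ← Matrix.toLin'_mul,
        ← Matrix.toLin'_mul, hgX, neg_mul, map_neg]
    obtain ⟨m, hm, hdet⟩ := Matrix.exists_det_eq_of_mul_self_of_trace hg htr
    rw [even_card_filter_mod_four_iff hk (hsum.trans hm), hdet]
    exact neg_one_pow_eq_one_iff_even (by norm_num)
  have hmat {g : Module.End ℂ (Fin n → ℂ)} (hg : g * g = 1)
      (hgX : g * Matrix.toLin' X = -(Matrix.toLin' X * g)) :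
      LinearMap.toMatrix' g * LinearMap.toMatrix' g = 1 ∧
        LinearMap.toMatrix' g * X = -X * LinearMap.toMatrix' g := by
    constructor
    · rw [← LinearMap.toMatrix'_mul, hg, LinearMap.toMatrix'_one]
    · apply Matrix.toLin'.injective
      rw [neg_mul, map_neg, Matrix.toLin'_mul, Matrix.toLin'_mul, Matrix.toLin'_toMatrix']
      exact hgX
  rw [hodd, hcount, Int.odd_coe_nat]
  rw [hcount, Int.odd_coe_nat] at hexists
  constructor
  · rintro ⟨g, hg₁, hg, hgX⟩ ⟨hk, -, hcard⟩
    exact Nat.not_even_iff_odd.mpr hcard ((hdet hk hg hgX).mp hg₁)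
  · intro h
    by_cases hk : ∀ i, Even (k i)
    · obtain ⟨hg, hgX⟩ := hmat (IsJordanBasis.alternating_mul_self (b := b) (s := 1) (by simp))
        (hb.alternating_anticommute 1)
      refine ⟨_, (hdet hk hg hgX).mpr ?_, hg, hgX⟩
      by_contra hcard
      rw [Nat.not_even_iff_odd] at hcard
      exact h ⟨hk, hexists hcard, hcard⟩
    · push Not at hk
      obtain ⟨i, hi⟩ := hk
      obtain ⟨g, hg₁, hg, hgX⟩ := hb.exists_of_odd (by simpa using hi)
      exact ⟨LinearMap.toMatrix' g, by rw [LinearMap.det_toMatrix', hg₁], hmat hg hgX⟩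
end

section
/- Let n ≥ 1 and let S, N ∈ M(n,ℂ) with S diagonalizable, N nilpotent, and S · N = N · S; set X = S + N and assume trace X = 0. Then there exists g ∈ M(n,ℂ) with det g = 1 and g X g⁻¹ = −X if and only if there exist σ ∈ M(n,ℂ) with det σ = 1 and σ S σ⁻¹ = −S, and h ∈ M(n,ℂ) with det h = 1, h S = S h, and h (σ N σ⁻¹) h⁻¹ = −N. (That is, X is Ad_{SL(n,ℂ)}-real if and only if its semisimple part S is Ad_{SL(n,ℂ)}-real via some σ, and −N and σNσ⁻¹ are conjugate inside the centralizer of S in SL(n,ℂ).) -/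
open Polynomial in
/-- A semiconjugation `a * x = y * a` carries over to polynomials in `x` and `y`. -/
theorem SemiconjBy.polynomial_aeval {R A : Type*} [CommSemiring R] [Semiring A] [Algebra R A]
    {a x y : A} (h : SemiconjBy a x y) (p : R[X]) :
    SemiconjBy a (aeval x p) (aeval y p) := by
  induction p using Polynomial.induction_on' with
  | add p q hp hq => simpa only [map_add] using hp.add_right hq
  | monomial k r =>
    simp only [aeval_monomial]
    exact SemiconjBy.mul_right (Algebra.commutes r a).symm (h.pow_right k)

namespace Matrix

variable {m K : Type*} [Fintype m] [DecidableEq m] [Field K]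

/-- A diagonalizable matrix induces a semisimple endomorphism. -/
theorem isSemisimple_toLinAlgEquiv'_of_semiconjBy_diagonal {A P : Matrix m m K} {D : m → K}
    (hP : IsUnit P) (h : SemiconjBy P (diagonal D) A) :
    Module.End.IsSemisimple (toLinAlgEquiv' A : Module.End K (m → K)) := by
  classical
  let p : Polynomial K := ∏ μ ∈ Finset.univ.image D, (Polynomial.X - Polynomial.C μ)
  have hp : Squarefree p :=
    (Polynomial.separable_prod_X_sub_C_iff' (f := id)).2 (fun _ _ _ _ h ↦ h) |>.squarefree
  have hD : Polynomial.aeval (diagonal D) p = 0 := by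
    rw [← diagonalAlgHom_apply (R := K) D, Polynomial.aeval_algHom_apply]
    suffices Polynomial.aeval D p = 0 by rw [this, map_zero]
    ext i
    rw [Polynomial.aeval_pi_apply]
    simp only [p, map_prod, Pi.zero_apply]
    exact Finset.prod_eq_zero (Finset.mem_image_of_mem D (Finset.mem_univ i)) (by simp)
  have hA : Polynomial.aeval A p = 0 := by
    have key := (h.polynomial_aeval p).eq
    rw [hD, mul_zero] at key
    exact hP.mul_left_eq_zero.1 key.symm
  refine Module.End.isSemisimple_of_squarefree_aeval_eq_zero hp ?_
  rw [Polynomial.aeval_algHom_apply, hA, map_zero]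

/-- Uniqueness of the Jordan–Chevalley decomposition for matrices. -/
theorem eq_and_eq_of_isNilpotent_of_semiconjBy_diagonal [PerfectField K]
    {S₁ N₁ P₁ S₂ N₂ P₂ : Matrix m m K} {D₁ D₂ : m → K}
    (hP₁ : IsUnit P₁) (hS₁ : SemiconjBy P₁ (diagonal D₁) S₁)
    (hP₂ : IsUnit P₂) (hS₂ : SemiconjBy P₂ (diagonal D₂) S₂)
    (hN₁ : IsNilpotent N₁) (hN₂ : IsNilpotent N₂)
    (hc₁ : Commute S₁ N₁) (hc₂ : Commute S₂ N₂) (h : S₁ + N₁ = S₂ + N₂) :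
    S₁ = S₂ ∧ N₁ = N₂ := by
  let e := toLinAlgEquiv' (R := K) (n := m)
  have key := Module.End.isNilpotent_isSemisimple_unique (hN₁.map e)
    (isSemisimple_toLinAlgEquiv'_of_semiconjBy_diagonal hP₁ hS₁) (hN₂.map e)
    (isSemisimple_toLinAlgEquiv'_of_semiconjBy_diagonal hP₂ hS₂)
    (hc₁.symm.map e) (hc₂.symm.map e)
    (by rw [← map_add, ← map_add, add_comm N₁, add_comm N₂, h])
  exact ⟨e.injective key.2, e.injective key.1⟩

end Matrix


/-- X = S + N (Jordan decomposition) is Ad_{SL(n,ℂ)}-real iff S is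
Ad_{SL(n,ℂ)}-real via some σ, and −N and σNσ⁻¹ are conjugate in the centralizer of S
in SL(n,ℂ). -/
theorem adSL_real_jordan_decomposition (n : ℕ) (hn : 1 ≤ n)
    (S N : Matrix (Fin n) (Fin n) ℂ)
    (hS : ∃ (P : Matrix (Fin n) (Fin n) ℂ) (D : Fin n → ℂ),
        IsUnit P ∧ S = P * Matrix.diagonal D * P⁻¹)
    (hN : IsNilpotent N) (hSN : S * N = N * S)
    (htr : (S + N).trace = 0) :
    (∃ g : Matrix (Fin n) (Fin n) ℂ, g.det = 1 ∧ g * (S + N) * g⁻¹ = -(S + N)) ↔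
      (∃ σ : Matrix (Fin n) (Fin n) ℂ, σ.det = 1 ∧ σ * S * σ⁻¹ = -S ∧
        ∃ h : Matrix (Fin n) (Fin n) ℂ, h.det = 1 ∧ h * S = S * h ∧
          h * (σ * N * σ⁻¹) * h⁻¹ = -N) := by
  constructor
  · rintro ⟨g, hg, hgX⟩
    obtain ⟨P, D, hP, rfl⟩ := hS
    set S := P * Matrix.diagonal D * P⁻¹ with hS
    have hPdet : IsUnit P.det := (Matrix.isUnit_iff_isUnit_det P).1 hP
    have hgdet : IsUnit g.det := hg ▸ isUnit_one
    have hgu : IsUnit g := (Matrix.isUnit_iff_isUnit_det g).2 hgdet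
    have hg' : g⁻¹ * g = 1 := Matrix.nonsing_inv_mul g hgdet
    have hSP : SemiconjBy P (Matrix.diagonal D) S := by
      rw [SemiconjBy, hS, Matrix.nonsing_inv_mul_cancel_right P _ hPdet]
    have hconj (A : Matrix (Fin n) (Fin n) ℂ) : SemiconjBy g A (g * A * g⁻¹) := by
      rw [SemiconjBy, Matrix.nonsing_inv_mul_cancel_right g _ hgdet]
    have hmul (A B : Matrix (Fin n) (Fin n) ℂ) :
        g * A * g⁻¹ * (g * B * g⁻¹) = g * (A * B) * g⁻¹ := by
      simp only [mul_assoc]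
      rw [← mul_assoc g⁻¹ g, hg', one_mul]
    have hnegS : SemiconjBy P (Matrix.diagonal (-D)) (-S) := by
      have := hSP.neg_right
      rwa [Matrix.diagonal_neg] at this
    have hNg : IsNilpotent (g * N * g⁻¹) := by
      obtain ⟨k, hk⟩ := hN
      refine ⟨k, ?_⟩
      have := ((hconj N).pow_right k).eq
      rw [hk, mul_zero] at this
      exact hgu.mul_left_eq_zero.1 this.symm
    obtain ⟨h₁, h₂⟩ := Matrix.eq_and_eq_of_isNilpotent_of_semiconjBy_diagonal
      (hgu.mul hP) ((hconj S).mul_left hSP) hP hnegS hNg hN.neg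
      (show _ = _ by rw [hmul, hmul, hSN]) (show _ = _ by rw [neg_mul_neg, neg_mul_neg, hSN])
      (by rw [← add_mul, ← mul_add, hgX, neg_add])
    exact ⟨g, hg, h₁, 1, Matrix.det_one, by simp, by simpa using h₂⟩
  · rintro ⟨σ, hσ, hσS, h, hh, hhS, hhN⟩
    refine ⟨h * σ, by rw [Matrix.det_mul, hh, hσ, one_mul], ?_⟩
    have hh' : h * h⁻¹ = 1 := Matrix.mul_nonsing_inv h (hh ▸ isUnit_one)
    calc h * σ * (S + N) * (h * σ)⁻¹
        = h * (σ * S * σ⁻¹) * h⁻¹ + h * (σ * N * σ⁻¹) * h⁻¹ := by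
          rw [Matrix.mul_inv_rev]; noncomm_ring
      _ = -(S + N) := by
          rw [hσS, hhN, mul_neg, neg_mul, hhS, mul_assoc, hh', mul_one, neg_add]
end

section
/- Let p₀, p be natural numbers and let μ : Fin p → ℂ satisfy μ j ≠ 0 for all j and μ j + μ k ≠ 0 for all j, k. Let X_s be the complex matrix indexed by Fin p₀ ⊕ (Fin p ⊕ Fin p) which is block diagonal with blocks: the zero p₀×p₀ matrix, diagonal μ, and diagonal (−μ). Suppose σ is a matrix over the same index type with det σ = 1 and σ · X_s = −X_s · σ. Then: (a) all entries of σ coupling the Fin p₀ block to the Fin p ⊕ Fin p block (in either direction) vanish; (b) the (2,2) block of σ (entries between the first Fin p copy and itself) and the (3,3) block (between the second Fin p copy and itself) vanish; (c) the (2,3) block R and the (3,2) block T of σ satisfy R j k = 0 and T j k = 0 whenever μ j ≠ μ k; and (d) the p₀×p₀ block of σ, as well as R and T, are invertible matrices. -/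
/-- If `σ` anticommutes with a diagonal matrix, each entry of `σ` coupling two diagonal values
with nonzero sum vanishes. -/
theorem Matrix.apply_eq_zero_of_mul_diagonal_eq_neg {n R : Type*} [Fintype n] [DecidableEq n]
    [CommRing R] [NoZeroDivisors R] {d : n → R} {σ : Matrix n n R}
    (h : σ * Matrix.diagonal d = -Matrix.diagonal d * σ) {a b : n} (hab : d a + d b ≠ 0) :
    σ a b = 0 := by
  have hentry := congrFun (congrFun h a) b
  rw [Matrix.neg_mul, Matrix.neg_apply, Matrix.mul_diagonal, Matrix.diagonal_mul] at hentry
  have hmul : (d a + d b) * σ a b = 0 := by linear_combination hentry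
  exact (mul_eq_zero.mp hmul).resolve_left hab

/-- A block antidiagonal matrix with square blocks is invertible iff both of its blocks are. -/
theorem Matrix.isUnit_fromBlocks_antidiagonal_iff {n R : Type*} [Fintype n] [DecidableEq n]
    [CommRing R] {B C : Matrix n n R} :
    IsUnit (Matrix.fromBlocks 0 B C 0) ↔ IsUnit B ∧ IsUnit C := by
  rw [← Matrix.isUnit_submatrix_equiv (Equiv.refl (n ⊕ n)) (Equiv.sumComm n n)]
  have hswap : (Matrix.fromBlocks 0 B C 0).submatrix (Equiv.refl (n ⊕ n)) (Equiv.sumComm n n) =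
      Matrix.fromBlocks B 0 0 C := Matrix.fromBlocks_submatrix_sum_swap_right _ _ _ _ _
  rw [hswap, Matrix.isUnit_fromBlocks_zero₂₁]

/-- block form of an element σ ∈ SL(p₀+2p,ℂ) conjugating the semisimple
element X_s = O_{p₀} ⊕ diag(μ) ⊕ diag(−μ) to −X_s. -/
theorem reverser_of_semisimple_block_form (p₀ p : ℕ) (μ : Fin p → ℂ)
    (hμ0 : ∀ j, μ j ≠ 0) (hμsum : ∀ j k, μ j + μ k ≠ 0)
    (Xs : Matrix (Fin p₀ ⊕ (Fin p ⊕ Fin p)) (Fin p₀ ⊕ (Fin p ⊕ Fin p)) ℂ)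
    (hXs : Xs = Matrix.fromBlocks 0 0 0
        (Matrix.fromBlocks (Matrix.diagonal μ) 0 0 (Matrix.diagonal fun j => -μ j)))
    (σ : Matrix (Fin p₀ ⊕ (Fin p ⊕ Fin p)) (Fin p₀ ⊕ (Fin p ⊕ Fin p)) ℂ)
    (hdet : σ.det = 1) (hσ : σ * Xs = -Xs * σ) :
    (∀ (i : Fin p₀) (j : Fin p ⊕ Fin p),
        σ (Sum.inl i) (Sum.inr j) = 0 ∧ σ (Sum.inr j) (Sum.inl i) = 0) ∧
    (∀ j k : Fin p,
        σ (Sum.inr (Sum.inl j)) (Sum.inr (Sum.inl k)) = 0 ∧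
        σ (Sum.inr (Sum.inr j)) (Sum.inr (Sum.inr k)) = 0) ∧
    (∀ j k : Fin p, μ j ≠ μ k →
        σ (Sum.inr (Sum.inl j)) (Sum.inr (Sum.inr k)) = 0 ∧
        σ (Sum.inr (Sum.inr j)) (Sum.inr (Sum.inl k)) = 0) ∧
    (IsUnit (Matrix.of fun i j : Fin p₀ => σ (Sum.inl i) (Sum.inl j)) ∧
     IsUnit (Matrix.of fun j k : Fin p => σ (Sum.inr (Sum.inl j)) (Sum.inr (Sum.inr k))) ∧
     IsUnit (Matrix.of fun j k : Fin p => σ (Sum.inr (Sum.inr j)) (Sum.inr (Sum.inl k)))) := by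
  have hdiag : Xs = Matrix.diagonal (Sum.elim 0 (Sum.elim μ fun j => -μ j)) := by
    rw [hXs, Matrix.fromBlocks_diagonal, ← Matrix.fromBlocks_diagonal 0,
      Matrix.diagonal_zero']
  rw [hdiag] at hσ
  have hcouple : ∀ (i : Fin p₀) (j : Fin p ⊕ Fin p),
      σ (Sum.inl i) (Sum.inr j) = 0 ∧ σ (Sum.inr j) (Sum.inl i) = 0 := by
    rintro i (j | j) <;> constructor <;>
      exact Matrix.apply_eq_zero_of_mul_diagonal_eq_neg hσ (by simp [hμ0 j])
  have hdiagBlocks : ∀ j k : Fin p,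
      σ (Sum.inr (Sum.inl j)) (Sum.inr (Sum.inl k)) = 0 ∧
      σ (Sum.inr (Sum.inr j)) (Sum.inr (Sum.inr k)) = 0 := by
    refine fun j k => ⟨Matrix.apply_eq_zero_of_mul_diagonal_eq_neg hσ (hμsum j k),
      Matrix.apply_eq_zero_of_mul_diagonal_eq_neg hσ fun h => hμsum j k ?_⟩
    simp only [Sum.elim_inr] at h
    linear_combination -h
  refine ⟨hcouple, hdiagBlocks, fun j k hjk => ?_, ?_⟩
  · have hsub : μ j - μ k ≠ 0 := sub_ne_zero.mpr hjk
    refine ⟨Matrix.apply_eq_zero_of_mul_diagonal_eq_neg hσ fun h => hsub ?_,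
      Matrix.apply_eq_zero_of_mul_diagonal_eq_neg hσ fun h => hsub ?_⟩ <;>
      simp only [Sum.elim_inr, Sum.elim_inl] at h
    · linear_combination h
    · linear_combination -h
  · have hblocks : σ = Matrix.fromBlocks
        (Matrix.of fun i j : Fin p₀ => σ (Sum.inl i) (Sum.inl j)) 0 0
        (Matrix.fromBlocks 0
          (Matrix.of fun j k : Fin p => σ (Sum.inr (Sum.inl j)) (Sum.inr (Sum.inr k)))
          (Matrix.of fun j k : Fin p => σ (Sum.inr (Sum.inr j)) (Sum.inr (Sum.inl k))) 0) := by
      ext (i | j | j) (i' | k | k) <;> simp [hcouple, hdiagBlocks]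
    have hunit : IsUnit σ := (Matrix.isUnit_iff_isUnit_det σ).mpr (hdet ▸ isUnit_one)
    rw [hblocks, Matrix.isUnit_fromBlocks_zero₂₁,
      Matrix.isUnit_fromBlocks_antidiagonal_iff] at hunit
    exact hunit
end
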